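/- arXiv:2601.14906 — 9 statements merged into one kernel-verified Lean document; each statement's English description precedes it below -/
import Mathlib

section
/- For every c ≥ 1 there exists k ∈ ℕ such that the following holds. Let G = (A,B,E) be a finite bipartite graph satisfying the linear neighborhood complexity bound with constant c, i.e., for every nonempty set S ⊆ A ∪ B we have |{N_G(v) ∩ S : v ∈ A ∪ B}| ≤ c·|S|. If no two distinct vertices of B have the same neighborhood in G and |A| ≥ 2, then there exist two distinct vertices u, v ∈ A that are k-near-twins in G. -/
/-- A finite bipartite graph: two disjoint finite sides `A`, `B` and an edge
set `E ⊆ A ×ˢ B`. -/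
structure BipGraph (V : Type) [DecidableEq V] where
  A : Finset V
  B : Finset V
  disj : Disjoint A B
  E : Finset (V × V)
  E_sub : E ⊆ A ×ˢ B

namespace BipGraph

variable {V : Type} [DecidableEq V]

/-- The set of neighbors of a vertex. -/
def nbr (G : BipGraph V) (v : V) : Finset V :=
  (G.A ∪ G.B).filter (fun w => (v, w) ∈ G.E ∨ (w, v) ∈ G.E)

end BipGraph

namespace Finset

variable {α ι : Type*} [DecidableEq α]

theorem Shatters.subset_of_powerset_filter {X T : Finset α} {p : Finset α → Prop}
    [DecidablePred p] (hT : (X.powerset.filter p).Shatters T) : T ⊆ X := by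
  obtain ⟨Q, hQ, hQT⟩ := hT (Finset.Subset.refl T)
  exact (Finset.inter_eq_left.mp hQT).trans (Finset.mem_powerset.mp (Finset.mem_filter.mp hQ).1)

/-- Weighted form of Haussler's bound on the number of edges of the one-inclusion graph of a set
family of VC dimension at most `d`. -/
theorem sum_min_insert_le_of_shatters_card_le (X : Finset α) :
    ∀ (w : Finset α → ℕ) (d : ℕ),
      (∀ T, (X.powerset.filter (fun Q => w Q ≠ 0)).Shatters T → T.card ≤ d) →
      ∑ x ∈ X, ∑ Q ∈ (X.erase x).powerset, min (w Q) (w (insert x Q)) ≤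
        d * ∑ Q ∈ X.powerset, w Q := by
  induction X using Finset.induction_on with
  | empty => intro w d _; simp
  | insert a X ha ih =>
    intro w d hd
    set w₁ : Finset α → ℕ := fun Q => max (w Q) (w (insert a Q)) with hw₁
    set w₂ : Finset α → ℕ := fun Q => min (w Q) (w (insert a Q)) with hw₂
    have hsum : ∑ Q ∈ (insert a X).powerset, w Q =
        ∑ Q ∈ X.powerset, w₁ Q + ∑ Q ∈ X.powerset, w₂ Q := by
      rw [Finset.sum_powerset_insert ha, ← Finset.sum_add_distrib, ← Finset.sum_add_distrib]
      exact Finset.sum_congr rfl fun Q _ => (max_add_min _ _).symm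
    have hedges : ∑ x ∈ insert a X, ∑ Q ∈ ((insert a X).erase x).powerset,
          min (w Q) (w (insert x Q)) ≤
        ∑ Q ∈ X.powerset, w₂ Q +
          (∑ x ∈ X, ∑ Q ∈ (X.erase x).powerset, min (w₁ Q) (w₁ (insert x Q)) +
            ∑ x ∈ X, ∑ Q ∈ (X.erase x).powerset, min (w₂ Q) (w₂ (insert x Q))) := by
      rw [Finset.sum_insert ha, Finset.erase_insert ha, ← Finset.sum_add_distrib]
      refine Nat.add_le_add_left (Finset.sum_le_sum fun x hx => ?_) _
      have hax : a ≠ x := fun h => ha (h ▸ hx)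
      rw [Finset.erase_insert_of_ne hax,
        Finset.sum_powerset_insert (fun h => ha (Finset.mem_of_mem_erase h)),
        ← Finset.sum_add_distrib, ← Finset.sum_add_distrib]
      refine Finset.sum_le_sum fun Q _ => ?_
      simp only [hw₁, hw₂, Finset.insert_comm x a Q]
      omega
    have h₁ : ∑ x ∈ X, ∑ Q ∈ (X.erase x).powerset, min (w₁ Q) (w₁ (insert x Q)) ≤
        d * ∑ Q ∈ X.powerset, w₁ Q := by
      refine ih w₁ d fun T hT => hd T fun t ht => ?_
      have hTX : T ⊆ X := hT.subset_of_powerset_filter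
      obtain ⟨Q, hQ, hQT⟩ := hT ht
      simp only [Finset.mem_filter, Finset.mem_powerset] at hQ
      by_cases h0 : w Q = 0
      · refine ⟨insert a Q, ?_, ?_⟩
        · simp only [Finset.mem_filter, Finset.mem_powerset]
          refine ⟨Finset.insert_subset_insert _ hQ.1, fun h => hQ.2 ?_⟩
          simp [hw₁, h0, h]
        · rw [Finset.inter_insert_of_notMem (fun h => ha (hTX h)), hQT]
      · exact ⟨Q, by
          simpa only [Finset.mem_filter, Finset.mem_powerset] using
            ⟨hQ.1.trans (Finset.subset_insert _ _), h0⟩, hQT⟩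
    have h₂ : ∀ T, (X.powerset.filter (fun Q => w₂ Q ≠ 0)).Shatters T → T.card + 1 ≤ d := by
      intro T hT
      have hTX : T ⊆ X := hT.subset_of_powerset_filter
      have haT : a ∉ T := fun h => ha (hTX h)
      rw [← Finset.card_insert_of_notMem haT]
      refine hd _ fun t ht => ?_
      obtain ⟨Q, hQ, hQT⟩ := hT (Finset.subset_insert_iff.mp ht)
      simp only [Finset.mem_filter, Finset.mem_powerset, hw₂] at hQ
      have haQ : a ∉ Q := fun h => ha (hQ.1 h)
      by_cases hat : a ∈ t
      · refine ⟨insert a Q, ?_, ?_⟩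
        · simp only [Finset.mem_filter, Finset.mem_powerset]
          exact ⟨Finset.insert_subset_insert _ hQ.1, by omega⟩
        · rw [← Finset.insert_inter_distrib, hQT, Finset.insert_erase hat]
      · refine ⟨Q, ?_, ?_⟩
        · simp only [Finset.mem_filter, Finset.mem_powerset]
          exact ⟨hQ.1.trans (Finset.subset_insert _ _), by omega⟩
        · rw [Finset.insert_inter_of_notMem haQ, hQT, Finset.erase_eq_of_notMem hat]
    rw [hsum]
    refine hedges.trans ?_
    rcases Nat.eq_zero_or_pos (∑ Q ∈ X.powerset, w₂ Q) with h0 | hpos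
    · have := ih w₂ 0 fun T hT => by
        obtain ⟨Q, hQ, -⟩ := hT (Finset.empty_subset T)
        simp only [Finset.mem_filter] at hQ
        exact absurd (Finset.sum_eq_zero_iff.mp h0 Q hQ.1) hQ.2
      rw [h0, add_zero]
      omega
    · obtain ⟨Q, hQ, hQ0⟩ := Finset.exists_ne_zero_of_sum_ne_zero hpos.ne'
      have hd1 : 1 ≤ d := by
        simpa using h₂ ∅ (Finset.shatters_empty.mpr ⟨Q, Finset.mem_filter.mpr ⟨hQ, hQ0⟩⟩)
      obtain ⟨e, rfl⟩ := Nat.exists_eq_add_of_le' hd1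
      have := ih w₂ e fun T hT => Nat.le_of_succ_le_succ (h₂ T hT)
      nlinarith

/-- In a family of sets any two of which differ in at least `k` points of `Z`, the points of `Z`
split the family evenly on average. -/
theorem mul_card_sub_one_le_two_mul_sum_min [DecidableEq ι] (N : ι → Finset α) (C : Finset ι)
    (Z : Finset α) (k : ℕ)
    (hsep : ∀ a ∈ C, ∀ b ∈ C, a ≠ b → k ≤ (Z.filter (fun x => x ∈ symmDiff (N a) (N b))).card) :
    k * (C.card - 1) ≤ 2 * ∑ x ∈ Z, min (C.filter (fun a => x ∉ N a)).card
      (C.filter (fun a => x ∈ N a)).card := by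
  rcases C.eq_empty_or_nonempty with rfl | hC
  · simp
  have hcount : ∀ x, ((C.offDiag).filter
      (fun p => x ∈ symmDiff (N p.1) (N p.2))).card ≤
      C.card * (2 * min (C.filter (fun a => x ∉ N a)).card
      (C.filter (fun a => x ∈ N a)).card) := by
    intro x
    set P := C.filter (fun a => x ∉ N a)
    set Q := C.filter (fun a => x ∈ N a)
    have hsub : (C.offDiag).filter (fun p => x ∈ symmDiff (N p.1) (N p.2)) ⊆
        P ×ˢ Q ∪ Q ×ˢ P := by
      intro p hp
      simp only [Finset.mem_filter, Finset.mem_offDiag, Finset.mem_symmDiff] at hp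
      simp only [P, Q, Finset.mem_union, Finset.mem_product, Finset.mem_filter]
      tauto
    have hPQ : Q.card + P.card = C.card := Finset.card_filter_add_card_filter_not _
    have hle := (Finset.card_le_card hsub).trans (Finset.card_union_le _ _)
    rw [Finset.card_product, Finset.card_product] at hle
    refine hle.trans ?_
    rw [← hPQ]
    rcases le_total P.card Q.card with h | h
    · rw [min_eq_left h]; nlinarith
    · rw [min_eq_right h]; nlinarith
  have hpairs : C.card * (C.card - 1) * k ≤
      ∑ x ∈ Z, ((C.offDiag).filter (fun p => x ∈ symmDiff (N p.1) (N p.2))).card := by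
    have hoff : C.offDiag.card = C.card * (C.card - 1) := by
      rw [Finset.offDiag_card, Nat.mul_sub_one]
    rw [← hoff]
    simp only [Finset.card_filter]
    rw [Finset.sum_comm, ← smul_eq_mul]
    refine Finset.card_nsmul_le_sum _ _ _ fun p hp => ?_
    rw [Finset.mem_offDiag] at hp
    rw [← Finset.card_filter]
    exact hsep _ hp.1 _ hp.2.1 hp.2.2
  have htotal := hpairs.trans (Finset.sum_le_sum fun x _ => hcount x)
  rw [← Finset.mul_sum, ← Finset.mul_sum, mul_assoc] at htotal
  have := Nat.le_of_mul_le_mul_left htotal hC.card_pos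
  linarith [mul_comm k (C.card - 1)]

theorem sum_powersetCard_succ_sum_erase {M : Type*} [AddCommMonoid M] (B : Finset α) (r : ℕ)
    (f : Finset α → α → M) :
    ∑ X ∈ B.powersetCard (r + 1), ∑ x ∈ X, f (X.erase x) x =
      ∑ Y ∈ B.powersetCard r, ∑ x ∈ B \ Y, f Y x := by
  rw [Finset.sum_sigma', Finset.sum_sigma']
  refine Finset.sum_bij' (fun p _ => ⟨p.1.erase p.2, p.2⟩) (fun p _ => ⟨insert p.2 p.1, p.2⟩)
    ?_ ?_ ?_ ?_ ?_
  · rintro ⟨X, x⟩ h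
    simp only [Finset.mem_sigma, Finset.mem_powersetCard, Finset.mem_sdiff] at h ⊢
    obtain ⟨⟨hX, hc⟩, hx⟩ := h
    exact ⟨⟨(Finset.erase_subset _ _).trans hX, by rw [Finset.card_erase_of_mem hx, hc]; rfl⟩,
      hX hx, Finset.notMem_erase _ _⟩
  · rintro ⟨Y, x⟩ h
    simp only [Finset.mem_sigma, Finset.mem_powersetCard, Finset.mem_sdiff] at h ⊢
    obtain ⟨⟨hY, hc⟩, hx, hxY⟩ := h
    exact ⟨⟨Finset.insert_subset hx hY, by rw [Finset.card_insert_of_notMem hxY, hc]⟩,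
      Finset.mem_insert_self _ _⟩
  · rintro ⟨X, x⟩ h
    simp only [Finset.mem_sigma] at h
    simp [Finset.insert_erase h.2]
  · rintro ⟨Y, x⟩ h
    simp only [Finset.mem_sigma, Finset.mem_sdiff] at h
    simp [Finset.erase_insert h.2.2]
  · rintro ⟨X, x⟩ _
    rfl

/-- The number of members of the family `N` on `A` whose trace on `Y` is `Q`. -/
def traceCard (A : Finset ι) (N : ι → Finset α) (Y Q : Finset α) : ℕ :=
  (A.filter (fun a => N a ∩ Y = Q)).card

theorem sum_powerset_traceCard (A : Finset ι) (N : ι → Finset α) (Y : Finset α) :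
    ∑ Q ∈ Y.powerset, traceCard A N Y Q = A.card :=
  (Finset.card_eq_sum_card_fiberwise fun _ _ =>
    Finset.mem_coe.mpr (Finset.mem_powerset.mpr Finset.inter_subset_right)).symm

theorem traceCard_insert_of_subset (A : Finset ι) (N : ι → Finset α) {Y Q : Finset α} {x : α}
    (hx : x ∉ Y) (hQ : Q ⊆ Y) :
    traceCard A N (insert x Y) Q =
      ((A.filter (fun a => N a ∩ Y = Q)).filter (fun a => x ∉ N a)).card := by
  rw [traceCard, Finset.filter_filter]
  congr 1
  refine Finset.filter_congr fun a _ => ?_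
  have hxQ : x ∉ Q := fun h => hx (hQ h)
  by_cases h : x ∈ N a
  · rw [Finset.inter_insert_of_mem h]
    simp only [h, not_true_eq_false, and_false, iff_false]
    exact fun e => hxQ (e ▸ Finset.mem_insert_self _ _)
  · rw [Finset.inter_insert_of_notMem h]
    simp [h]

theorem traceCard_insert_insert (A : Finset ι) (N : ι → Finset α) {Y Q : Finset α} {x : α}
    (hx : x ∉ Y) (hQ : Q ⊆ Y) :
    traceCard A N (insert x Y) (insert x Q) =
      ((A.filter (fun a => N a ∩ Y = Q)).filter (fun a => x ∈ N a)).card := by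
  rw [traceCard, Finset.filter_filter]
  congr 1
  refine Finset.filter_congr fun a _ => ?_
  have hxQ : x ∉ Q := fun h => hx (hQ h)
  have hxN : x ∉ N a ∩ Y := fun h => hx (Finset.mem_inter.mp h).2
  by_cases h : x ∈ N a
  · rw [Finset.inter_insert_of_mem h]
    simp only [h, and_true]
    refine ⟨fun e => ?_, fun e => e ▸ rfl⟩
    rw [← Finset.erase_insert hxN, e, Finset.erase_insert hxQ]
  · rw [Finset.inter_insert_of_notMem h]
    simp only [h, and_false, iff_false]
    exact fun e => hxN (e ▸ Finset.mem_insert_self _ _)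

theorem card_le_sum_traceCard_sub_one_add (A : Finset ι) (N : ι → Finset α) (Y : Finset α) :
    A.card ≤ ∑ Q ∈ Y.powerset, (traceCard A N Y Q - 1) + (A.image (fun a => N a ∩ Y)).card := by
  have himage : A.image (fun a => N a ∩ Y) =
      Y.powerset.filter (fun Q => traceCard A N Y Q ≠ 0) := by
    ext Q
    simp only [Finset.mem_image, Finset.mem_filter, Finset.mem_powerset, traceCard, ne_eq,
      Finset.card_eq_zero, Finset.filter_eq_empty_iff, not_forall, not_not]
    constructor
    · rintro ⟨a, ha, rfl⟩
      exact ⟨Finset.inter_subset_right, a, ha, rfl⟩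
    · rintro ⟨-, a, ha, h⟩
      exact ⟨a, ha, h⟩
  rw [himage, Finset.card_filter, ← Finset.sum_add_distrib, ← sum_powerset_traceCard A N Y]
  refine Finset.sum_le_sum fun Q _ => ?_
  split_ifs <;> omega

/-- The core inequality of Haussler's packing lemma. -/
theorem mul_succ_le_of_separated [DecidableEq ι] {A : Finset ι} {B : Finset α}
    {N : ι → Finset α} {k d r : ℕ} (hA : A.Nonempty) (hN : ∀ a ∈ A, N a ⊆ B)
    (hsep : ∀ a ∈ A, ∀ b ∈ A, a ≠ b → k ≤ (symmDiff (N a) (N b)).card)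
    (hvc : ∀ T ⊆ B, (∀ t ⊆ T, ∃ a ∈ A, N a ∩ T = t) → T.card ≤ d)
    (htrace : ∀ Y ⊆ B, Y.card = r → 2 * (A.image (fun a => N a ∩ Y)).card ≤ A.card)
    (hr : r ≤ B.card) :
    k * (r + 1) ≤ 4 * d * B.card := by
  set f : Finset α → α → ℕ := fun Y x => ∑ Q ∈ Y.powerset,
    min (traceCard A N (insert x Y) Q) (traceCard A N (insert x Y) (insert x Q)) with hf
  have hupper : ∑ X ∈ B.powersetCard (r + 1), ∑ x ∈ X, f (X.erase x) x ≤
      B.card.choose (r + 1) * (d * A.card) := by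
    rw [← Finset.card_powersetCard, ← smul_eq_mul]
    refine Finset.sum_le_card_nsmul _ _ _ fun X hX => ?_
    rw [Finset.mem_powersetCard] at hX
    rw [← sum_powerset_traceCard A N X]
    refine le_of_eq_of_le ?_
      (sum_min_insert_le_of_shatters_card_le X (traceCard A N X) d fun T hT => ?_)
    · refine Finset.sum_congr rfl fun x hx => ?_
      simp only [hf, Finset.insert_erase hx]
    · have hTX : T ⊆ X := hT.subset_of_powerset_filter
      refine hvc T (hTX.trans hX.1) fun t ht => ?_
      obtain ⟨Q, hQ, hQT⟩ := hT ht
      obtain ⟨a, ha⟩ := Finset.card_ne_zero.mp (Finset.mem_filter.mp hQ).2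
      rw [Finset.mem_filter] at ha
      refine ⟨a, ha.1, ?_⟩
      rw [← hQT, ← ha.2, Finset.inter_left_comm, Finset.inter_eq_left.mpr hTX]
  have hlower : B.card.choose r * (k * A.card) ≤
      4 * ∑ Y ∈ B.powersetCard r, ∑ x ∈ B \ Y, f Y x := by
    rw [← Finset.card_powersetCard, ← smul_eq_mul, Finset.mul_sum]
    refine Finset.card_nsmul_le_sum _ _ _ fun Y hY => ?_
    rw [Finset.mem_powersetCard] at hY
    have hclass : ∀ Q ∈ Y.powerset, k * (traceCard A N Y Q - 1) ≤
        2 * ∑ x ∈ B \ Y, min (traceCard A N (insert x Y) Q)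
          (traceCard A N (insert x Y) (insert x Q)) := by
      intro Q hQ
      rw [Finset.mem_powerset] at hQ
      refine (mul_card_sub_one_le_two_mul_sum_min N (A.filter (fun a => N a ∩ Y = Q)) (B \ Y) k
        fun a ha b hb hab => ?_).trans_eq ?_
      · rw [Finset.mem_filter] at ha hb
        refine (hsep a ha.1 b hb.1 hab).trans (Finset.card_le_card fun x hx => ?_)
        have hxB : x ∈ B := by
          rcases Finset.mem_symmDiff.mp hx with h | h
          exacts [hN a ha.1 h.1, hN b hb.1 h.1]
        refine Finset.mem_filter.mpr ⟨Finset.mem_sdiff.mpr ⟨hxB, fun hxY => ?_⟩, hx⟩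
        have := Finset.ext_iff.mp (ha.2.trans hb.2.symm) x
        simp only [Finset.mem_inter, hxY, and_true] at this
        rw [Finset.mem_symmDiff] at hx
        tauto
      · congr 1
        refine Finset.sum_congr rfl fun x hx => ?_
        have hxY := (Finset.mem_sdiff.mp hx).2
        rw [traceCard_insert_of_subset A N hxY hQ, traceCard_insert_insert A N hxY hQ]
    have hclasses := Finset.sum_le_sum hclass
    rw [← Finset.mul_sum, ← Finset.mul_sum, Finset.sum_comm] at hclasses
    have hcard := card_le_sum_traceCard_sub_one_add A N Y
    have htr := htrace Y hY.1 hY.2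
    have hhalf : A.card ≤ 2 * ∑ Q ∈ Y.powerset, (traceCard A N Y Q - 1) := by omega
    have := Nat.mul_le_mul_left k hhalf
    simp only [hf]
    linarith
  rw [← sum_powersetCard_succ_sum_erase] at hlower
  have hchoose : B.card.choose r * (k * A.card) ≤
      4 * (B.card.choose (r + 1) * (d * A.card)) :=
    hlower.trans (Nat.mul_le_mul_left 4 hupper)
  have hpos : 0 < B.card.choose r * A.card := Nat.mul_pos (Nat.choose_pos hr) hA.card_pos
  refine Nat.le_of_mul_le_mul_left (?_ : B.card.choose r * A.card * (k * (r + 1)) ≤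
    B.card.choose r * A.card * (4 * d * B.card)) hpos
  calc B.card.choose r * A.card * (k * (r + 1))
      = B.card.choose r * (k * A.card) * (r + 1) := by ring
    _ ≤ 4 * (B.card.choose (r + 1) * (d * A.card)) * (r + 1) := Nat.mul_le_mul_right _ hchoose
    _ = 4 * d * A.card * (B.card.choose (r + 1) * (r + 1)) := by ring
    _ = 4 * d * A.card * (B.card.choose r * (B.card - r)) := by rw [Nat.choose_succ_right_eq]
    _ ≤ 4 * d * A.card * (B.card.choose r * B.card) := by gcongr; omega
    _ = B.card.choose r * A.card * (4 * d * B.card) := by ring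

end Finset

theorem Nat.sq_le_two_mul_two_pow (t : ℕ) : t ^ 2 ≤ 2 * 2 ^ t := by
  induction t with
  | zero => simp
  | succ t ih =>
    rcases Nat.lt_or_ge t 3 with h | h
    · interval_cases t <;> norm_num
    · rw [pow_succ 2 t]
      nlinarith

namespace BipGraph

variable {V : Type} [DecidableEq V] (G : BipGraph V)

theorem nbr_subset_right {v : V} (hv : v ∈ G.A) : G.nbr v ⊆ G.B := by
  intro w hw
  have hvB : v ∉ G.B := Finset.disjoint_left.mp G.disj hv
  rcases (Finset.mem_filter.mp hw).2 with h | h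
  · exact (Finset.mem_product.mp (G.E_sub h)).2
  · exact absurd (Finset.mem_product.mp (G.E_sub h)).2 hvB

theorem nbr_subset_left {v : V} (hv : v ∈ G.B) : G.nbr v ⊆ G.A := by
  intro w hw
  have hvA : v ∉ G.A := Finset.disjoint_right.mp G.disj hv
  rcases (Finset.mem_filter.mp hw).2 with h | h
  · exact absurd (Finset.mem_product.mp (G.E_sub h)).1 hvA
  · exact (Finset.mem_product.mp (G.E_sub h)).1

end BipGraph

/-- For every `c ≥ 1` there is `k` such that in every finite bipartite graph
with linear neighborhood complexity (with constant `c`), no twins on side `B`,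
and `|A| ≥ 2`, there are two distinct vertices of `A` that are `k`-near-twins. -/
theorem haussler_near_twins :
    ∀ c : ℕ, 1 ≤ c → ∃ k : ℕ,
      ∀ (V : Type) [DecidableEq V] (G : BipGraph V),
        (∀ S : Finset V, S ⊆ G.A ∪ G.B → S.Nonempty →
          ((G.A ∪ G.B).image (fun v => G.nbr v ∩ S)).card ≤ c * S.card) →
        (∀ u ∈ G.B, ∀ v ∈ G.B, G.nbr u = G.nbr v → u = v) →
        2 ≤ G.A.card →
        ∃ u ∈ G.A, ∃ v ∈ G.A, u ≠ v ∧ (symmDiff (G.nbr u) (G.nbr v)).card ≤ k := by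
  intro c hc
  refine ⟨16 * c ^ 3 + 2 * c ^ 2, fun V _ G hcomp htwin hA2 => ?_⟩
  by_contra! hsep
  have hApos : G.A.Nonempty := Finset.card_pos.mp (by omega)
  have htraces : ∀ S ⊆ G.B, S.Nonempty →
      (G.A.image (fun v => G.nbr v ∩ S)).card ≤ c * S.card := fun S hS hne =>
    (Finset.card_le_card (Finset.image_subset_image Finset.subset_union_left)).trans
      (hcomp S (hS.trans Finset.subset_union_right) hne)
  have hBA : G.B.card ≤ c * G.A.card := by
    refine le_trans ?_ (hcomp G.A Finset.subset_union_left hApos)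
    refine le_trans (Finset.card_image_of_injOn ?_).ge
      (Finset.card_le_card (Finset.image_subset_image Finset.subset_union_right))
    intro u hu v hv huv
    simp only [Finset.inter_eq_left.mpr (G.nbr_subset_left hu),
      Finset.inter_eq_left.mpr (G.nbr_subset_left hv)] at huv
    exact htwin u hu v hv huv
  have hlarge : 2 * c ^ 2 < G.B.card := by
    obtain ⟨u, hu, v, hv, huv⟩ := Finset.one_lt_card.mp hA2
    have hsub : symmDiff (G.nbr u) (G.nbr v) ⊆ G.B := fun x hx =>
      (Finset.mem_symmDiff.mp hx).elim (fun h => G.nbr_subset_right hu h.1)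
        fun h => G.nbr_subset_right hv h.1
    have := (hsep u hu v hv huv).trans_le (Finset.card_le_card hsub)
    omega
  have hBpos : G.B.Nonempty := Finset.card_pos.mp (by omega)
  have hAB : G.A.card ≤ c * G.B.card := by
    refine le_trans (Finset.card_image_of_injOn ?_).ge (htraces G.B subset_rfl hBpos)
    intro u hu v hv huv
    simp only [Finset.inter_eq_left.mpr (G.nbr_subset_right hu),
      Finset.inter_eq_left.mpr (G.nbr_subset_right hv)] at huv
    by_contra hne
    have := hsep u hu v hv hne
    simp [huv] at this
  have hA2c : 2 * c ≤ G.A.card := by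
    have : c * (2 * c) < c * G.A.card := by nlinarith
    exact (Nat.lt_of_mul_lt_mul_left this).le
  set r := G.A.card / (2 * c) with hr
  have hr1 : 1 ≤ r := Nat.div_pos hA2c (by omega)
  have hrle : 2 * c * r ≤ G.A.card := Nat.mul_div_le _ _
  have hrlt : G.A.card < 2 * c * (r + 1) := Nat.lt_mul_div_succ _ (by omega)
  have hrB : r ≤ G.B.card := Nat.le_of_mul_le_mul_left (by nlinarith : c * r ≤ c * G.B.card) hc
  have hmain := Finset.mul_succ_le_of_separated (k := 16 * c ^ 3 + 2 * c ^ 2 + 1) (d := 2 * c)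
    (r := r) hApos (fun a ha => G.nbr_subset_right ha) hsep ?_ ?_ hrB
  · have h : (16 * c ^ 3 + 2 * c ^ 2 + 1) * (r + 1) ≤ 16 * c ^ 3 * (r + 1) := by
      calc (16 * c ^ 3 + 2 * c ^ 2 + 1) * (r + 1) ≤ 4 * (2 * c) * G.B.card := hmain
        _ ≤ 4 * (2 * c) * (c * (2 * c * (r + 1))) := by
          gcongr
          exact hBA.trans (Nat.mul_le_mul_left c hrlt.le)
        _ = 16 * c ^ 3 * (r + 1) := by ring
    have := Nat.le_of_mul_le_mul_right h (Nat.succ_pos r)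
    have := Nat.zero_le (2 * c ^ 2)
    omega
  · intro T hT hshat
    rcases T.eq_empty_or_nonempty with rfl | hne
    · simp
    have hsub : T.powerset ⊆ G.A.image (fun v => G.nbr v ∩ T) := fun t ht =>
      Finset.mem_image.mpr (hshat t (Finset.mem_powerset.mp ht))
    have hpow := (Finset.card_le_card hsub).trans (htraces T hT hne)
    rw [Finset.card_powerset] at hpow
    have hsq := Nat.sq_le_two_mul_two_pow T.card
    exact Nat.le_of_mul_le_mul_right (by nlinarith : T.card * T.card ≤ 2 * c * T.card)
      hne.card_pos
  · intro Y hY hYr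
    have := htraces Y hY (Finset.card_pos.mp (by omega))
    rw [hYr] at this
    nlinarith
end

section
/- There exists a function β : ℕ × ℕ → ℕ with the following property. Let G = (A,B,E) be a bipartite graph with A = {ℓ_1,…,ℓ_m} consisting of m distinct vertices, and let P_1,…,P_m be nonempty sets partitioning B such that: (i) P_i ⊆ N_G(ℓ_i) for every i ∈ [m]; (ii) N_G(ℓ_i) ∩ P_j = ∅ for all j < i; and (iii) N_G(ℓ_i) ∩ P_j ≠ ∅ for all j > i. If m > β(a,b), then G contains the half-graph of order a as an induced subgraph, or G contains the 1-subdivision of the complete graph K_b as an induced subgraph in which all principal vertices lie in A. -/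
namespace BipGraph

variable {V : Type} [DecidableEq V]

/-- Adjacency in a bipartite graph. -/
def adj (G : BipGraph V) (u v : V) : Prop :=
  (u, v) ∈ G.E ∨ (v, u) ∈ G.E

end BipGraph

/-- `G` contains the half-graph of order `t` as an induced subgraph:
distinct vertices `u 1, …, u t` on the left and `v 1, …, v t` on the right with
`u i` adjacent to `v j` exactly when `i ≤ j`.  (For bipartite graphs this
orientation is no loss of generality, cf. Remark 2.12 of the paper.) -/
def HasInducedHalfGraph {V : Type} [DecidableEq V] (G : BipGraph V) (t : ℕ) : Prop :=
  ∃ u v : Fin t → V, Function.Injective u ∧ Function.Injective v ∧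
    (∀ i, u i ∈ G.A) ∧ (∀ j, v j ∈ G.B) ∧
    (∀ i j, G.adj (u i) (v j) ↔ i ≤ j)

/-- `G` contains the `1`-subdivision of the complete graph `K b` as an induced
subgraph with all principal vertices `p i` on the left side `A`. -/
def HasInducedSubdividedClique {V : Type} [DecidableEq V] (G : BipGraph V) (b : ℕ) : Prop :=
  ∃ (p : Fin b → V) (s : Fin b → Fin b → V),
    Function.Injective p ∧ (∀ i, p i ∈ G.A) ∧
    (∀ i j : Fin b, i < j → s i j ∈ G.B) ∧
    (∀ i j i' j' : Fin b, i < j → i' < j' → s i j = s i' j' → i = i' ∧ j = j') ∧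
    (∀ i j k : Fin b, i < j → (G.adj (p k) (s i j) ↔ k = i ∨ k = j))

/-- Ramsey's theorem for `r`-element sets and finitely many colours. -/
theorem exists_monochromatic_subset {κ : Type} [Finite κ] (r n : ℕ) :
    ∃ N : ℕ, ∀ (α : Type) [LinearOrder α] (S : Finset α) (c : Finset α → κ), N ≤ S.card →
      ∃ T ⊆ S, T.card = n ∧ ∃ k, ∀ F ⊆ T, F.card = r → c F = k := by
  induction r generalizing n with
  | zero =>
    refine ⟨n, fun α _ S c hS => ?_⟩
    obtain ⟨T, hTS, hT⟩ := Finset.exists_subset_card_eq hS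
    exact ⟨T, hTS, hT, c ∅, fun F _ hF => by rw [Finset.card_eq_zero.1 hF]⟩
  | succ r ih =>
    have prehomogeneous (t : ℕ) : ∃ N : ℕ, ∀ (α : Type) [LinearOrder α] (S : Finset α)
        (c : Finset α → κ), N ≤ S.card → ∃ T ⊆ S, T.card = t ∧ ∃ d : α → κ,
          ∀ x ∈ T, ∀ F ⊆ T, (∀ y ∈ F, x < y) → F.card = r → c (insert x F) = d x := by
      induction t with
      | zero =>
        exact ⟨0, fun α _ S c _ => ⟨∅, by simp, by simp, fun x => c {x}, by simp⟩⟩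
      | succ t iht =>
        obtain ⟨N, hN⟩ := iht
        obtain ⟨M, hM⟩ := ih N
        refine ⟨M + 1, fun α _ S c hS => ?_⟩
        have hne : S.Nonempty := Finset.card_pos.1 (by omega)
        set x := S.min' hne
        have hxS : x ∈ S := S.min'_mem hne
        obtain ⟨S', hS', hS'card, k, hk⟩ := hM α (S.erase x) (fun F => c (insert x F))
          (by rw [Finset.card_erase_of_mem hxS]; omega)
        obtain ⟨T, hTS', hT, d, hd⟩ := hN α S' c hS'card.ge
        have hTS : T ⊆ S.erase x := hTS'.trans hS'
        have hxT : x ∉ T := fun h => Finset.notMem_erase x S (hTS h)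
        have hlt (y) (hy : y ∈ T) : x < y := Finset.min'_lt_of_mem_erase_min' S hne (hTS hy)
        refine ⟨insert x T, Finset.insert_subset hxS (hTS.trans (Finset.erase_subset _ _)),
          by rw [Finset.card_insert_of_notMem hxT, hT], Function.update d x k, ?_⟩
        intro z hz F hF hzF hFr
        have hxF : x ∉ F := by
          intro hxF
          have hzx := hzF x hxF
          rcases Finset.mem_insert.1 hz with rfl | hzT
          · exact lt_irrefl _ hzx
          · exact lt_asymm hzx (hlt z hzT)
        have hFT : F ⊆ T := (Finset.subset_insert_iff_of_notMem hxF).1 hF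
        rcases Finset.mem_insert.1 hz with rfl | hzT
        · rw [Function.update_self]
          exact hk F (hFT.trans hTS') hFr
        · rw [Function.update_of_ne (ne_of_mem_of_not_mem hzT hxT)]
          exact hd z hzT F hFT hzF hFr
    have := Fintype.ofFinite κ
    classical
    obtain ⟨N, hN⟩ := prehomogeneous (Fintype.card κ * n + 1)
    refine ⟨N, fun α _ S c hS => ?_⟩
    obtain ⟨T, hTS, hT, d, hd⟩ := hN α S c hS
    obtain ⟨k, -, hk⟩ := Finset.exists_lt_card_fiber_of_mul_lt_card_of_maps_to
      (s := T) (t := Finset.univ) (f := d) (n := n) (fun _ _ => Finset.mem_univ _)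
      (by rw [hT, Finset.card_univ]; omega)
    obtain ⟨U, hU, hUn⟩ := Finset.exists_subset_card_eq hk.le
    have hUT : U ⊆ T := hU.trans (Finset.filter_subset _ _)
    refine ⟨U, hUT.trans hTS, hUn, k, fun F hF hFr => ?_⟩
    have hne : F.Nonempty := Finset.card_pos.1 (by omega)
    have hmem := F.min'_mem hne
    rw [← Finset.insert_erase hmem, hd _ (hUT (hF hmem)) _
      ((Finset.erase_subset _ _).trans (hF.trans hUT))
      (fun y hy => Finset.min'_lt_of_mem_erase_min' F hne hy)
      (by rw [Finset.card_erase_of_mem hmem]; omega)]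
    exact (Finset.mem_filter.1 (hU (hF hmem))).2

/-- Ramsey's theorem for colourings of increasing triples. -/
theorem exists_monochromatic_triples {κ : Type} [Finite κ] [Inhabited κ] (n : ℕ) :
    ∃ N : ℕ, ∀ (α : Type) [LinearOrder α] (S : Finset α) (c : α → α → α → κ), N ≤ S.card →
      ∃ T ⊆ S, T.card = n ∧ ∃ k, ∀ x ∈ T, ∀ y ∈ T, ∀ z ∈ T, x < y → y < z → c x y z = k := by
  obtain ⟨N, hN⟩ := exists_monochromatic_subset (κ := κ) 3 n
  refine ⟨N, fun α _ S c hS => ?_⟩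
  let g : {p : α × α × α // p.1 < p.2.1 ∧ p.2.1 < p.2.2} → Finset α :=
    fun p => {p.1.1, p.1.2.1, p.1.2.2}
  have hg : Function.Injective g := by
    rintro ⟨⟨x, y, z⟩, hxy, hyz⟩ ⟨⟨x', y', z'⟩, hxy', hyz'⟩ h
    have hmem (w : α) : w = x ∨ w = y ∨ w = z ↔ w = x' ∨ w = y' ∨ w = z' := by
      simpa [g] using Finset.ext_iff.1 h w
    have hx := (hmem x).1 (by simp)
    have hy := (hmem y).1 (by simp)
    have hz := (hmem z).1 (by simp)
    have hx' := (hmem x').2 (by simp)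
    have hy' := (hmem y').2 (by simp)
    have hz' := (hmem z').2 (by simp)
    clear hmem h g
    simp only at hxy hyz hxy' hyz'
    simp only [Subtype.mk.injEq, Prod.mk.injEq]
    grind
  obtain ⟨T, hTS, hT, k, hk⟩ := hN α S
    (Function.extend g (fun p => c p.1.1 p.1.2.1 p.1.2.2) default) hS
  refine ⟨T, hTS, hT, k, fun x hx y hy z hz hxy hyz => ?_⟩
  rw [← hk {x, y, z} (by simp [Finset.insert_subset_iff, hx, hy, hz])
    (Finset.card_eq_three.2 ⟨x, y, z, hxy.ne, (hxy.trans hyz).ne, hyz.ne, rfl⟩)]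
  exact (hg.extend_apply (fun p => c p.1.1 p.1.2.1 p.1.2.2) default
    ⟨(x, y, z), hxy, hyz⟩).symm

/-- The Ramsey-like auxiliary lemma: there is `β : ℕ × ℕ → ℕ` such that any
bipartite graph with `A = {ℓ 1, …, ℓ m}` and a partition `P 1, …, P m` of `B`
with `P i ⊆ N(ℓ i)`, `N(ℓ i) ∩ P j = ∅` for `j < i` and `N(ℓ i) ∩ P j ≠ ∅` for
`j > i`, where `m > β (a, b)`, contains an induced half-graph of order `a` or
an induced `1`-subdivision of `K b` with all principal vertices in `A`. -/
theorem ramsey_aux :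
    ∃ β : ℕ × ℕ → ℕ,
      ∀ (V : Type) [DecidableEq V] (G : BipGraph V) (m : ℕ)
        (ℓ : Fin m → V) (P : Fin m → Finset V),
        Function.Injective ℓ →
        G.A = Finset.image ℓ Finset.univ →
        (∀ i, (P i).Nonempty) →
        (∀ i j, i ≠ j → Disjoint (P i) (P j)) →
        Finset.univ.biUnion P = G.B →
        (∀ i, P i ⊆ G.nbr (ℓ i)) →
        (∀ i j : Fin m, j < i → G.nbr (ℓ i) ∩ P j = ∅) →
        (∀ i j : Fin m, i < j → (G.nbr (ℓ i) ∩ P j).Nonempty) →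
        ∀ a b : ℕ, β (a, b) < m →
          HasInducedHalfGraph G a ∨ HasInducedSubdividedClique G b := by
  choose N hN using exists_monochromatic_triples (κ := Prop × Prop)
  refine ⟨fun p => N (p.1 + p.2 + 1), ?_⟩
  intro V _ G m ℓ P hℓ hA hP hdisj hB hown hbefore hafter a b hm
  have hchoice (i j : Fin m) : ∃ v ∈ P j, i < j → v ∈ G.nbr (ℓ i) := by
    by_cases hij : i < j
    · obtain ⟨v, hv⟩ := hafter i j hij
      rw [Finset.mem_inter] at hv
      exact ⟨v, hv.2, fun _ => hv.1⟩
    · obtain ⟨v, hv⟩ := hP j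
      exact ⟨v, hv, fun h => absurd h hij⟩
  choose f hfP hf using hchoice
  have hfB (i j) : f i j ∈ G.B := hB ▸ Finset.mem_biUnion.2 ⟨j, Finset.mem_univ _, hfP i j⟩
  have hadj {i j} (hij : i < j) : G.adj (ℓ i) (f i j) := (Finset.mem_filter.1 (hf i j hij)).2
  have hadj_self (i j) : G.adj (ℓ j) (f i j) := (Finset.mem_filter.1 (hown j (hfP i j))).2
  have hnadj (i) {j k} (hjk : j < k) : ¬ G.adj (ℓ k) (f i j) := by
    intro h
    have hmem : f i j ∈ G.nbr (ℓ k) ∩ P j := Finset.mem_inter.2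
      ⟨Finset.mem_filter.2 ⟨Finset.mem_union_right _ (hfB i j), h⟩, hfP i j⟩
    simp [hbefore k j hjk] at hmem
  have hpart {i j i' j'} (h : f i j = f i' j') : j = j' := by
    by_contra hne
    exact Finset.disjoint_left.1 (hdisj j j' hne) (hfP i j) (h ▸ hfP i' j')
  have hℓA (i) : ℓ i ∈ G.A := hA ▸ Finset.mem_image_of_mem _ (Finset.mem_univ _)
  obtain ⟨T, -, hT, ⟨later, earlier⟩, hmono⟩ := hN (a + b + 1) (Fin m) Finset.univ
    (fun x y z => (G.adj (ℓ y) (f x z), G.adj (ℓ x) (f y z)))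
    (by simpa using hm.le)
  let e := T.orderEmbOfFin hT
  have he {i j k : Fin (a + b + 1)} (hij : i < j) (hjk : j < k) :
      (G.adj (ℓ (e j)) (f (e i) (e k)) ↔ later) ∧
        (G.adj (ℓ (e i)) (f (e j) (e k)) ↔ earlier) := by
    have h := hmono (e i) (T.orderEmbOfFin_mem hT i) (e j) (T.orderEmbOfFin_mem hT j) (e k)
      (T.orderEmbOfFin_mem hT k) (e.lt_iff_lt.2 hij) (e.lt_iff_lt.2 hjk)
    rw [Prod.mk.injEq] at h
    exact ⟨iff_of_eq h.1, iff_of_eq h.2⟩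
  -- In a half-graph the right vertices are `f (e (q k)) (e (k + 1))` for a suitable `q`.
  have half_graph (q : Fin a → Fin (a + b + 1)) (hq : ∀ i j : Fin a, i < j →
      G.adj (ℓ (e ⟨i + 1, by omega⟩)) (f (e (q j)) (e ⟨j + 1, by omega⟩))) :
      HasInducedHalfGraph G a := by
    refine ⟨fun i => ℓ (e ⟨i + 1, by omega⟩),
      fun j => f (e (q j)) (e ⟨j + 1, by omega⟩), ?_, ?_, fun _ => hℓA _, fun _ => hfB _ _, ?_⟩
    · intro i j h
      simpa [Fin.ext_iff] using e.injective (hℓ h)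
    · intro i j h
      simpa [Fin.ext_iff] using e.injective (hpart h)
    · intro i j
      rcases lt_trichotomy i j with hij | rfl | hij
      · exact iff_of_true (hq i j hij) hij.le
      · exact iff_of_true (hadj_self _ _) le_rfl
      · exact iff_of_false (hnadj _ (e.lt_iff_lt.2 (by simpa using hij))) hij.not_ge
  by_cases hlater : later
  · refine .inl (half_graph (fun _ => 0) fun i j hij => ?_)
    exact (he (by simp [Fin.lt_def]) (by simpa using hij)).1.2 hlater
  by_cases hearlier : earlier
  · refine .inl (half_graph (fun j => ⟨j, by omega⟩) fun i j hij => ?_)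
    rcases (Nat.succ_le_of_lt (Fin.lt_def.1 hij)).lt_or_eq with h | h
    · exact (he (by simpa [Fin.lt_def] using h) (by simp [Fin.lt_def])).2.2 hearlier
    · have hij' : (⟨i + 1, by omega⟩ : Fin (a + b + 1)) = ⟨j, by omega⟩ := Fin.ext h
      rw [hij']
      exact hadj (e.lt_iff_lt.2 (by simp [Fin.lt_def]))
  · right
    let w : Fin b ↪o Fin m := (Fin.castLEOrderEmb (by omega)).trans e
    have hw (i j k : Fin b) (hij : i < j) : G.adj (ℓ (w k)) (f (w i) (w j)) ↔ k = i ∨ k = j := by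
      rcases lt_trichotomy k j with hkj | rfl | hjk
      · rcases lt_trichotomy k i with hki | rfl | hik
        · exact iff_of_false (fun h => hearlier ((he hki hij).2.1 h)) (by simp [hki.ne, hkj.ne])
        · exact iff_of_true (hadj (w.lt_iff_lt.2 hij)) (.inl rfl)
        · exact iff_of_false (fun h => hlater ((he hik hkj).1.1 h)) (by simp [hik.ne', hkj.ne])
      · exact iff_of_true (hadj_self _ _) (.inr rfl)
      · exact iff_of_false (hnadj _ (w.lt_iff_lt.2 hjk))
          (by simp [hjk.ne', (hij.trans hjk).ne'])
    refine ⟨fun i => ℓ (w i), fun i j => f (w i) (w j), hℓ.comp w.injective, fun _ => hℓA _,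
      fun _ _ _ => hfB _ _, ?_, hw⟩
    intro i j i' j' hij hij' h
    obtain rfl : j = j' := w.injective (hpart h)
    have hf_eq : f (w i) (w j) = f (w i') (w j) := h
    have hi := (hw i' j i hij').1 (hf_eq ▸ hadj (w.lt_iff_lt.2 hij))
    exact ⟨hi.resolve_right hij.ne, rfl⟩
end

section
/- Let G be a bipartite graph and let G_1,…,G_m be a left branching of G. Fix i ∈ [m] and let G' be the graph obtained from the bipartite complement of G_i by deleting all isolated vertices. Let G'_1,…,G'_{m'} be a right branching of G', fix j ∈ [m'], and let G'' be the bipartite complement of G'_j. If G'' contains an induced half-graph of order t, then G contains an induced half-graph of order t+1. -/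
namespace BipGraph

variable {V : Type} [DecidableEq V]

/-- The bipartite complement of `G`. -/
def bipCompl (G : BipGraph V) : BipGraph V where
  A := G.A
  B := G.B
  disj := G.disj
  E := (G.A ×ˢ G.B) \ G.E
  E_sub := Finset.sdiff_subset

/-- The graph obtained from `G` by deleting all isolated vertices. -/
def removeIsolated (G : BipGraph V) : BipGraph V where
  A := G.A.filter (fun v => (G.nbr v).Nonempty)
  B := G.B.filter (fun v => (G.nbr v).Nonempty)
  disj := Disjoint.mono (Finset.filter_subset _ _) (Finset.filter_subset _ _) G.disj
  E := G.E
  E_sub := by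
    intro e he
    have h1 := G.E_sub he
    rw [Finset.mem_product] at h1 ⊢
    have he' : (e.1, e.2) ∈ G.E := by simpa using he
    constructor
    · exact Finset.mem_filter.mpr ⟨h1.1, ⟨e.2,
        Finset.mem_filter.mpr ⟨Finset.mem_union_right _ h1.2, Or.inl he'⟩⟩⟩
    · exact Finset.mem_filter.mpr ⟨h1.2, ⟨e.1,
        Finset.mem_filter.mpr ⟨Finset.mem_union_left _ h1.1, Or.inr he'⟩⟩⟩

/-- `H` is an induced subgraph of `G`. -/
def IsInducedSubgraph (H G : BipGraph V) : Prop :=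
  H.A ⊆ G.A ∧ H.B ⊆ G.B ∧ H.E = G.E.filter (fun e => e.1 ∈ H.A ∧ e.2 ∈ H.B)

end BipGraph

/-- A left branching of `G`. -/
structure IsLeftBranching {V : Type} [DecidableEq V] (G : BipGraph V) {m : ℕ}
    (H : Fin m → BipGraph V) (ℓ : Fin m → V) : Prop where
  induced : ∀ i, (H i).IsInducedSubgraph G
  leaders_inj : Function.Injective ℓ
  leader_mem : ∀ i, ℓ i ∈ (H i).A
  leader_dom : ∀ i, ∀ v ∈ (H i).B, (ℓ i, v) ∈ (H i).E
  edge_cover : ∀ e ∈ G.E, ∃ i, e ∈ (H i).E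
  right_disj : ∀ i j, i ≠ j → Disjoint (H i).B (H j).B
  right_union : Finset.univ.biUnion (fun i => (H i).B) = G.B

/-- A right branching of `G` (the roles of the two sides exchanged). -/
structure IsRightBranching {V : Type} [DecidableEq V] (G : BipGraph V) {m : ℕ}
    (H : Fin m → BipGraph V) (ℓ : Fin m → V) : Prop where
  induced : ∀ i, (H i).IsInducedSubgraph G
  leaders_inj : Function.Injective ℓ
  leader_mem : ∀ i, ℓ i ∈ (H i).B
  leader_dom : ∀ i, ∀ u ∈ (H i).A, (u, ℓ i) ∈ (H i).E
  edge_cover : ∀ e ∈ G.E, ∃ i, e ∈ (H i).E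
  left_disj : ∀ i j, i ≠ j → Disjoint (H i).A (H j).A
  left_union : Finset.univ.biUnion (fun i => (H i).A) = G.A

namespace BipGraph

variable {V : Type} [DecidableEq V]

lemma mem_sides (G : BipGraph V) {a b : V} (h : (a, b) ∈ G.E) : a ∈ G.A ∧ b ∈ G.B :=
  Finset.mem_product.mp (G.E_sub h)

lemma adj_iff (G : BipGraph V) {a b : V} (ha : a ∈ G.A) : G.adj a b ↔ (a, b) ∈ G.E :=
  ⟨fun h => h.resolve_right fun h' =>
    Finset.disjoint_left.mp G.disj ha (G.mem_sides h').2, Or.inl⟩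

lemma mem_bipCompl (G : BipGraph V) {a b : V} (ha : a ∈ G.A) (hb : b ∈ G.B) :
    (a, b) ∈ G.bipCompl.E ↔ (a, b) ∉ G.E := by
  simp [bipCompl, ha, hb]

lemma IsInducedSubgraph.mem_iff {H G : BipGraph V} (h : H.IsInducedSubgraph G) {a b : V}
    (ha : a ∈ H.A) (hb : b ∈ H.B) : (a, b) ∈ H.E ↔ (a, b) ∈ G.E := by
  simp [h.2.2, ha, hb]

end BipGraph

/-- Adding a left vertex adjacent to every `v b` and a right vertex adjacent to it but to
no `u a` extends a half-graph by one. -/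
lemma HasInducedHalfGraph.cons {V : Type} [DecidableEq V] {G : BipGraph V} {t : ℕ}
    {u v : Fin t → V} {x y : V} (hu : ∀ a, u a ∈ G.A) (hv : ∀ b, v b ∈ G.B)
    (huI : Function.Injective u) (hvI : Function.Injective v)
    (huv : ∀ a b, (u a, v b) ∈ G.E ↔ a ≤ b) (hxy : (x, y) ∈ G.E)
    (hxv : ∀ b, (x, v b) ∈ G.E) (huy : ∀ a, (u a, y) ∉ G.E) :
    HasInducedHalfGraph G (t + 1) := by
  have hA : ∀ a, (Fin.cons x u : Fin (t + 1) → V) a ∈ G.A :=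
    Fin.cases (G.mem_sides hxy).1 hu
  refine ⟨Fin.cons x u, Fin.cons y v, ?_, ?_, hA, Fin.cases (G.mem_sides hxy).2 hv, ?_⟩
  · refine Fin.cons_injective_iff.mpr ⟨?_, huI⟩
    rintro ⟨a, rfl⟩
    exact huy a hxy
  · refine Fin.cons_injective_iff.mpr ⟨?_, hvI⟩
    rintro ⟨b, rfl⟩
    exact huy b ((huv b b).mpr le_rfl)
  · intro a b
    rw [G.adj_iff (hA a)]
    cases a using Fin.cases <;> cases b using Fin.cases <;> simp [hxy, hxv, huy, huv]

/-- Growing a half-graph: if `G 1, …, G m` is a left branching of `G`,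
`G'` is the bipartite complement of the branch `G i` with isolated vertices
deleted, `G' 1, …, G' m'` is a right branching of `G'`, and the bipartite
complement `G''` of the branch `G' j` contains an induced half-graph of order
`t`, then `G` contains an induced half-graph of order `t + 1`. -/
theorem halfgraph_grow
    (V : Type) [DecidableEq V] (G : BipGraph V)
    (m : ℕ) (H : Fin m → BipGraph V) (ℓ : Fin m → V)
    (hL : IsLeftBranching G H ℓ) (i : Fin m)
    (m' : ℕ) (H' : Fin m' → BipGraph V) (ℓ' : Fin m' → V)
    (hR : IsRightBranching (((H i).bipCompl).removeIsolated) H' ℓ') (j : Fin m')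
    (t : ℕ) (ht : HasInducedHalfGraph ((H' j).bipCompl) t) :
    HasInducedHalfGraph G (t + 1) := by
  obtain ⟨u, v, huI, hvI, hu, hv, huv⟩ := ht
  have hA : ∀ a ∈ (H' j).A, a ∈ (H i).A := fun a ha =>
    Finset.filter_subset _ _ ((hR.induced j).1 ha)
  have hB : ∀ b ∈ (H' j).B, b ∈ (H i).B := fun b hb =>
    Finset.filter_subset _ _ ((hR.induced j).2.1 hb)
  have compl_iff : ∀ a ∈ (H' j).A, ∀ b ∈ (H' j).B, (a, b) ∈ (H' j).E ↔ (a, b) ∉ G.E :=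
    fun a ha b hb => by
      rw [(hR.induced j).mem_iff ha hb, ← (hL.induced i).mem_iff (hA a ha) (hB b hb)]
      exact (H i).mem_bipCompl (hA a ha) (hB b hb)
  have leader_adj : ∀ b ∈ (H' j).B, (ℓ i, b) ∈ G.E := fun b hb =>
    ((hL.induced i).mem_iff (hL.leader_mem i) (hB b hb)).mp (hL.leader_dom i b (hB b hb))
  refine HasInducedHalfGraph.cons (fun a => (hL.induced i).1 (hA _ (hu a)))
    (fun b => (hL.induced i).2.1 (hB _ (hv b))) huI hvI (fun a b => ?_)
    (leader_adj _ (hR.leader_mem j)) (fun b => leader_adj _ (hv b))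
    (fun a => (compl_iff _ (hu a) _ (hR.leader_mem j)).mp (hR.leader_dom j _ (hu a)))
  rw [← huv a b, (H' j).bipCompl.adj_iff (hu a), (H' j).mem_bipCompl (hu a) (hv b),
    compl_iff _ (hu a) _ (hv b), not_not]
end

section
/- Let G = (A,B,E) be a bipartite graph and let (T, G(·)) be a branching tree for G. Let u ∈ A, v ∈ B, and let p be a node of T such that both u and v are vertices of G(p) but no child q of p has both u and v among the vertices of G(q). Then uv ∈ E(G) if and only if the number of nodes on the path from the root of T to p (inclusive) is even; equivalently, if and only if the depth of p is odd. -/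
/-- A branching tree for a bipartite graph `G`: a finite rooted tree whose
nodes carry bipartite graphs (with sides contained in those of `G`); the root
carries `G`, a node is a leaf iff its graph is edgeless, and the children of a
non-leaf node `p` carry exactly the bipartite complements of the branches of a
left branching (if `depth p` is even) or a right branching (if `depth p` is
odd) of the graph of `p` with isolated vertices deleted. -/
structure BranchingTree (V : Type) [DecidableEq V] (G : BipGraph V) where
  ι : Type
  fintype : Fintype ι
  root : ι
  parent : ι → ι
  depth : ι → ℕ
  Gr : ι → BipGraph V
  root_depth : depth root = 0
  parent_depth : ∀ p, p ≠ root → depth (parent p) + 1 = depth p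
  root_graph : Gr root = G
  sides : ∀ p, (Gr p).A ⊆ G.A ∧ (Gr p).B ⊆ G.B
  leaf_no_children : ∀ p, (Gr p).E = ∅ → ∀ q, q ≠ root → parent q ≠ p
  branch : ∀ p, (Gr p).E ≠ ∅ →
    ∃ (m : ℕ) (H : Fin m → BipGraph V) (ℓ : Fin m → V) (child : Fin m → ι),
      (Even (depth p) → IsLeftBranching ((Gr p).removeIsolated) H ℓ) ∧
      (¬ Even (depth p) → IsRightBranching ((Gr p).removeIsolated) H ℓ) ∧
      Function.Injective child ∧
      (∀ i, child i ≠ root ∧ parent (child i) = p) ∧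
      (∀ q, q ≠ root → parent q = p → ∃ i, q = child i) ∧
      (∀ i, Gr (child i) = (H i).bipCompl)


namespace BranchingTree

variable {V : Type} [DecidableEq V] {G : BipGraph V}

/-- An edge of the graph at a node survives as a pair of vertices at some child. -/
theorem exists_child_of_edge (T : BranchingTree V G) {p : T.ι} {u v : V}
    (h : (u, v) ∈ (T.Gr p).E) :
    ∃ q, q ≠ T.root ∧ T.parent q = p ∧ u ∈ (T.Gr q).A ∧ v ∈ (T.Gr q).B := by
  obtain ⟨m, H, ℓ, child, hl, hr, -, hchild, -, hG⟩ := T.branch p (Finset.ne_empty_of_mem h)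
  obtain ⟨i, hi⟩ : ∃ i, (u, v) ∈ (H i).E := by
    by_cases hp : Even (T.depth p)
    · exact (hl hp).edge_cover _ h
    · exact (hr hp).edge_cover _ h
  have hm := Finset.mem_product.mp ((H i).E_sub hi)
  refine ⟨child i, (hchild i).1, (hchild i).2, ?_, ?_⟩ <;> rw [hG i]
  exacts [hm.1, hm.2]

/-- The vertices at a child are vertices at its parent, and adjacency is complemented. -/
theorem parent_edge_iff (T : BranchingTree V G) {q : T.ι} (hq : q ≠ T.root) {u v : V}
    (hu : u ∈ (T.Gr q).A) (hv : v ∈ (T.Gr q).B) :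
    u ∈ (T.Gr (T.parent q)).A ∧ v ∈ (T.Gr (T.parent q)).B ∧
      ((u, v) ∈ (T.Gr q).E ↔ (u, v) ∉ (T.Gr (T.parent q)).E) := by
  have hne : (T.Gr (T.parent q)).E ≠ ∅ := fun h => T.leaf_no_children _ h q hq rfl
  obtain ⟨m, H, ℓ, child, hl, hr, -, -, hex, hG⟩ := T.branch _ hne
  obtain ⟨i, hi⟩ := hex q hq rfl
  have hind : (H i).IsInducedSubgraph (T.Gr (T.parent q)).removeIsolated := by
    by_cases hp : Even (T.depth (T.parent q))
    · exact (hl hp).induced i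
    · exact (hr hp).induced i
  have hGq : T.Gr q = (H i).bipCompl := (congrArg T.Gr hi).trans (hG i)
  rw [hGq] at hu hv ⊢
  obtain ⟨hA, hB, hE⟩ := hind
  change u ∈ (H i).A at hu
  change v ∈ (H i).B at hv
  refine ⟨(Finset.mem_filter.mp (hA hu)).1, (Finset.mem_filter.mp (hB hv)).1, ?_⟩
  simp [BipGraph.bipCompl, hE, BipGraph.removeIsolated, hu, hv]

/-- The graph at a node of even depth agrees with `G` on its vertices, and the graph at a node
of odd depth agrees with the bipartite complement of `G`. -/
theorem edge_iff (T : BranchingTree V G) {u v : V} {p : T.ι}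
    (hu : u ∈ (T.Gr p).A) (hv : v ∈ (T.Gr p).B) :
    (u, v) ∈ (T.Gr p).E ↔ ((u, v) ∈ G.E ↔ Even (T.depth p)) := by
  induction hn : T.depth p generalizing p with
  | zero =>
    have hp : p = T.root := by
      by_contra h
      have := T.parent_depth p h
      omega
    simp [hp, T.root_graph]
  | succ n ih =>
    have hp : p ≠ T.root := by
      rintro rfl
      have := T.root_depth
      omega
    have hd := T.parent_depth p hp
    obtain ⟨hu', hv', he⟩ := T.parent_edge_iff hp hu hv
    rw [he, ih hu' hv' (by omega), Nat.even_add_one]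
    tauto

end BranchingTree

/-- In a branching tree for `G`, if `u ∈ A` and `v ∈ B` are both vertices of
the graph at a node `p` while no child of `p` contains both, then `uv` is an
edge of `G` if and only if the number of nodes on the root-to-`p` path is
even, i.e. iff the depth of `p` is odd. -/
theorem branching_tree_adjacency_parity
    (V : Type) [DecidableEq V] (G : BipGraph V) (T : BranchingTree V G)
    (u v : V) (hu : u ∈ G.A) (hv : v ∈ G.B) (p : T.ι)
    (hup : u ∈ (T.Gr p).A ∪ (T.Gr p).B)
    (hvp : v ∈ (T.Gr p).A ∪ (T.Gr p).B)
    (hnochild : ∀ q : T.ι, q ≠ T.root → T.parent q = p →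
        ¬ (u ∈ (T.Gr q).A ∪ (T.Gr q).B ∧ v ∈ (T.Gr q).A ∪ (T.Gr q).B)) :
    (u, v) ∈ G.E ↔ Odd (T.depth p) := by
  have hupA : u ∈ (T.Gr p).A := (Finset.mem_union.mp hup).resolve_right fun h =>
    Finset.disjoint_left.mp G.disj hu ((T.sides p).2 h)
  have hvpB : v ∈ (T.Gr p).B := (Finset.mem_union.mp hvp).resolve_left fun h =>
    Finset.disjoint_left.mp G.disj ((T.sides p).1 h) hv
  have hne : (u, v) ∉ (T.Gr p).E := by
    intro h
    obtain ⟨q, hq, hqp, hqu, hqv⟩ := T.exists_child_of_edge h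
    exact hnochild q hq hqp ⟨Finset.mem_union_left _ hqu, Finset.mem_union_right _ hqv⟩
  rw [T.edge_iff hupA hvpB] at hne
  rw [← Nat.not_even_iff_odd]
  tauto
end

section
/- Let T be a finite rooted tree of height at most h, let U be a finite set disjoint from the nodes of T, and let H be a graph with vertex set V(T) ∪ U whose edge set consists of the edges of T together with some edges between U and V(T), such that: (i) whenever u ∈ U is adjacent in H to a node q of T that is not the root, u is also adjacent to the parent of q; and (ii) for every u ∈ U and every node p of T, u is adjacent to at most k children of p. Then every u ∈ U has degree at most Σ_{d=0}^{h} k^d in H, and H is (Σ_{d=0}^{h} k^d)-degenerate. -/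
open scoped Classical

/-- A finite rooted tree, given by a root, a parent map and a depth function
(these axioms force every node to reach the root by iterating `parent`). -/
structure ParentTree (ι : Type) where
  root : ι
  parent : ι → ι
  depth : ι → ℕ
  root_depth : depth root = 0
  parent_depth : ∀ p, p ≠ root → depth (parent p) + 1 = depth p

namespace ParentTree

variable {ι : Type} (T : ParentTree ι)

/-- The root is the only node of depth `0`. -/
theorem eq_root_of_depth_eq_zero {p : ι} (hp : T.depth p = 0) : p = T.root := by
  by_contra hne
  have := T.parent_depth p hne
  omega

/-- A node of positive depth is not the root. -/
theorem ne_root_of_depth_eq_succ {p : ι} {d : ℕ} (hp : T.depth p = d + 1) : p ≠ T.root := by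
  rintro rfl
  have := T.root_depth
  omega

/-- An upward closed set of nodes containing at most `k` children of each node
has at most `k ^ d` elements of depth `d`. -/
theorem card_filter_depth_le {N : Finset ι} {k : ℕ}
    (hup : ∀ q ∈ N, q ≠ T.root → T.parent q ∈ N)
    (hfan : ∀ p, (N.filter (fun q => T.parent q = p ∧ q ≠ T.root)).card ≤ k) (d : ℕ) :
    (N.filter (fun q => T.depth q = d)).card ≤ k ^ d := by
  induction d with
  | zero =>
    rw [pow_zero, Finset.card_le_one]
    intro a ha b hb
    rw [T.eq_root_of_depth_eq_zero (Finset.mem_filter.1 ha).2,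
      T.eq_root_of_depth_eq_zero (Finset.mem_filter.1 hb).2]
  | succ d ih =>
    have hmaps : ∀ q ∈ N.filter (fun q => T.depth q = d + 1),
        T.parent q ∈ N.filter (fun q => T.depth q = d) := by
      intro q hq
      obtain ⟨hqN, hqd⟩ := Finset.mem_filter.1 hq
      have hne := T.ne_root_of_depth_eq_succ hqd
      have := T.parent_depth q hne
      exact Finset.mem_filter.2 ⟨hup q hqN hne, by omega⟩
    calc (N.filter (fun q => T.depth q = d + 1)).card
        ≤ k * (N.filter (fun q => T.depth q = d)).card := by
          refine Finset.card_le_mul_card_image_of_maps_to hmaps k fun p _ => ?_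
          refine (Finset.card_le_card fun q hq => ?_).trans (hfan p)
          simp only [Finset.mem_filter] at hq ⊢
          exact ⟨hq.1.1, hq.2, T.ne_root_of_depth_eq_succ hq.1.2⟩
      _ ≤ k * k ^ d := Nat.mul_le_mul_left k ih
      _ = k ^ (d + 1) := (pow_succ' k d).symm

/-- In a tree of height at most `h`, an upward closed set of nodes containing at most `k`
children of each node has at most `∑ d ≤ h, k ^ d` elements. -/
theorem card_le_sum_pow {N : Finset ι} {h k : ℕ} (hheight : ∀ p, T.depth p ≤ h)
    (hup : ∀ q ∈ N, q ≠ T.root → T.parent q ∈ N)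
    (hfan : ∀ p, (N.filter (fun q => T.parent q = p ∧ q ≠ T.root)).card ≤ k) :
    N.card ≤ ∑ d ∈ Finset.range (h + 1), k ^ d := by
  rw [Finset.card_eq_sum_card_fiberwise (f := T.depth) (t := Finset.range (h + 1))
    fun p _ => by simpa [Nat.lt_succ_iff] using hheight p]
  exact Finset.sum_le_sum fun d _ => T.card_filter_depth_le hup hfan d

end ParentTree

/-- Let `H` be a graph on the nodes of a rooted tree `T` of height at most `h`
together with a set `U`, whose edges are the tree edges plus some edges
between `U` and the tree, such that (i) neighborhoods of vertices of `U` in the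
tree are upward closed, and (ii) every `u ∈ U` is adjacent to at most `k`
children of any node.  Then every `u ∈ U` has degree at most `∑ d ≤ h, k ^ d`
in `H`, and `H` is `(∑ d ≤ h, k ^ d)`-degenerate. -/
theorem tree_attachment_degenerate
    (ι U : Type) [Fintype ι] [Fintype U] [DecidableEq ι] [DecidableEq U]
    (T : ParentTree ι) (h k : ℕ) (hheight : ∀ p, T.depth p ≤ h)
    (H : SimpleGraph (ι ⊕ U))
    (htree : ∀ p q : ι, H.Adj (Sum.inl p) (Sum.inl q) ↔
        (p = T.parent q ∧ q ≠ T.root) ∨ (q = T.parent p ∧ p ≠ T.root))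
    (hUU : ∀ u u' : U, ¬ H.Adj (Sum.inr u) (Sum.inr u'))
    (hup : ∀ (u : U) (q : ι), H.Adj (Sum.inr u) (Sum.inl q) → q ≠ T.root →
        H.Adj (Sum.inr u) (Sum.inl (T.parent q)))
    (hfan : ∀ (u : U) (p : ι),
        (Finset.univ.filter (fun q : ι =>
          T.parent q = p ∧ q ≠ T.root ∧ H.Adj (Sum.inr u) (Sum.inl q))).card ≤ k) :
    (∀ u : U,
        (Finset.univ.filter (fun w : ι ⊕ U => H.Adj (Sum.inr u) w)).card ≤
          ∑ d ∈ Finset.range (h + 1), k ^ d) ∧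
    (∀ S : Finset (ι ⊕ U), S.Nonempty → ∃ v ∈ S,
        (S.filter (fun w => H.Adj v w)).card ≤ ∑ d ∈ Finset.range (h + 1), k ^ d) := by
  have hdeg : ∀ u : U, (Finset.univ.filter (fun w : ι ⊕ U => H.Adj (Sum.inr u) w)).card ≤
      ∑ d ∈ Finset.range (h + 1), k ^ d := by
    intro u
    let N : Finset ι := Finset.univ.filter (fun q => H.Adj (Sum.inr u) (Sum.inl q))
    have hN : N.card ≤ ∑ d ∈ Finset.range (h + 1), k ^ d := by
      refine T.card_le_sum_pow hheight (fun q hq hne => ?_) fun p => ?_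
      · exact Finset.mem_filter.2 ⟨Finset.mem_univ _, hup u q (Finset.mem_filter.1 hq).2 hne⟩
      · refine (Finset.card_le_card fun q hq => ?_).trans (hfan u p)
        simp only [N, Finset.mem_filter, Finset.mem_univ, true_and] at hq ⊢
        exact ⟨hq.2.1, hq.2.2, hq.1⟩
    refine (Finset.card_le_card (t := N.image Sum.inl) fun w hw => ?_).trans
      (Finset.card_image_le.trans hN)
    have hadj := (Finset.mem_filter.1 hw).2
    rcases w with q | u'
    · exact Finset.mem_image_of_mem _ (Finset.mem_filter.2 ⟨Finset.mem_univ _, hadj⟩)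
    · exact (hUU u u' hadj).elim
  refine ⟨hdeg, fun S hS => ?_⟩
  by_cases hU : ∃ u : U, Sum.inr u ∈ S
  · obtain ⟨u, hu⟩ := hU
    exact ⟨_, hu, (Finset.card_le_card
      (Finset.filter_subset_filter _ (Finset.subset_univ S))).trans (hdeg u)⟩
  · obtain ⟨v, hv, hmax⟩ := S.exists_max_image (Sum.elim T.depth fun _ => 0) hS
    refine ⟨v, hv, ?_⟩
    rcases v with p | u
    · have hsub : S.filter (fun w => H.Adj (Sum.inl p) w) ⊆ {Sum.inl (T.parent p)} := by
        intro w hw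
        obtain ⟨hwS, hadj⟩ := Finset.mem_filter.1 hw
        rcases w with q | u
        · rcases (htree p q).1 hadj with ⟨hpq, hq⟩ | ⟨hqp, -⟩
          · have hlt := T.parent_depth q hq
            have hle : T.depth q ≤ T.depth p := hmax _ hwS
            rw [← hpq] at hlt
            omega
          · rw [hqp]
            exact Finset.mem_singleton_self _
        · exact (hU ⟨u, hwS⟩).elim
      calc (S.filter (fun w => H.Adj (Sum.inl p) w)).card
          ≤ 1 := Finset.card_le_card hsub
        _ = k ^ 0 := (pow_zero k).symm
        _ ≤ ∑ d ∈ Finset.range (h + 1), k ^ d :=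
          Finset.single_le_sum (f := fun d => k ^ d) (fun _ _ => Nat.zero_le _)
            (Finset.mem_range.2 h.succ_pos)
    · exact (hU ⟨u, hv⟩).elim
end

section
/- Let G = (A,B,E) be a bipartite graph, let P_1,…,P_m be nonempty sets partitioning B, and let ℓ_1,…,ℓ_m be distinct vertices of A with P_i ⊆ N_G(ℓ_i) for every i, such that every vertex of A has a neighbor in at most k of the parts. Let K be the graph with vertex set [m] in which distinct i, j are adjacent if and only if ℓ_i has a neighbor in P_j or ℓ_j has a neighbor in P_i. Then for every S ⊆ [m] the induced subgraph K[S] has at most k·|S| edges; consequently K is 2k-degenerate and admits a proper coloring with at most 2k+1 colors. -/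
open scoped Classical

/-- Adjacency of the auxiliary graph `K` on `[m]`: distinct `i, j` are adjacent
iff `ℓ i` has a neighbor in `P j` or `ℓ j` has a neighbor in `P i`. -/
def leaderAdj {V : Type} [DecidableEq V] (G : BipGraph V) {m : ℕ}
    (ℓ : Fin m → V) (P : Fin m → Finset V) (i j : Fin m) : Prop :=
  i ≠ j ∧ ((G.nbr (ℓ i) ∩ P j).Nonempty ∨ (G.nbr (ℓ j) ∩ P i).Nonempty)

/-- Orienting each edge along `R`, the symmetrization of a relation of out-degree at most `k`
has at most `k * #S` edges inside `S`. -/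
theorem card_symm_edges_le {ι : Type*} [Fintype ι] [LinearOrder ι] (R : ι → ι → Prop)
    [DecidableRel R] (k : ℕ)
    (hR : ∀ i, (Finset.univ.filter (R i)).card ≤ k) (S : Finset ι) :
    ((S ×ˢ S).filter (fun e => e.1 < e.2 ∧ (R e.1 e.2 ∨ R e.2 e.1))).card ≤ k * S.card := by
  calc
    _ ≤ (S.sigma fun i => Finset.univ.filter (R i)).card := by
      refine Finset.card_le_card_of_injOn
        (fun e => if R e.1 e.2 then ⟨e.1, e.2⟩ else ⟨e.2, e.1⟩) ?_ ?_
      · rintro ⟨a, b⟩ h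
        simp only [Finset.coe_filter, Finset.mem_product, Set.mem_ofPred_eq] at h
        by_cases hab : R a b
        · simp [hab, h.1.1]
        · simpa [hab, h.1.2] using h.2.2
      · rintro ⟨a, b⟩ h ⟨c, d⟩ h' heq
        simp only [Finset.coe_filter, Finset.mem_product, Set.mem_ofPred_eq] at h h'
        have hab := h.2.1
        have hcd := h'.2.1
        dsimp only at heq
        split_ifs at heq <;> simp only [Sigma.mk.injEq, heq_eq_eq] at heq <;>
          obtain ⟨rfl, rfl⟩ := heq
        · rfl
        · exact absurd hab hcd.asymm
        · exact absurd hab hcd.asymm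
        · rfl
    _ = ∑ i ∈ S, (Finset.univ.filter (R i)).card := Finset.card_sigma _ _
    _ ≤ S.card • k := Finset.sum_le_card_nsmul _ _ _ fun i _ => hR i
    _ = k * S.card := by rw [smul_eq_mul, mul_comm]

/-- The symmetrization of a relation of out-degree at most `k` is `2 * k`-degenerate. -/
theorem exists_card_symm_le {ι : Type*} [Fintype ι] (R : ι → ι → Prop) [DecidableRel R] (k : ℕ)
    (hR : ∀ i, (Finset.univ.filter (R i)).card ≤ k) (S : Finset ι) (hS : S.Nonempty) :
    ∃ i ∈ S, (S.filter (fun j => R i j ∨ R j i)).card ≤ 2 * k := by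
  have hout : ∑ i ∈ S, (S.filter (R i)).card ≤ S.card * k :=
    Finset.sum_le_card_nsmul _ _ _ fun i _ =>
      (Finset.card_le_card (Finset.filter_subset_filter _ (Finset.subset_univ S))).trans (hR i)
  have hin : ∑ i ∈ S, (S.filter fun j => R j i).card = ∑ i ∈ S, (S.filter (R i)).card :=
    (Finset.sum_card_bipartiteAbove_eq_sum_card_bipartiteBelow R).symm
  refine Finset.exists_le_of_sum_le hS ?_
  calc
    _ ≤ ∑ i ∈ S, ((S.filter (R i)).card + (S.filter fun j => R j i).card) :=
      Finset.sum_le_sum fun i _ => by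
        rw [Finset.filter_or]
        exact Finset.card_union_le _ _
    _ ≤ ∑ _i ∈ S, 2 * k := by
      rw [Finset.sum_add_distrib, hin, Finset.sum_const, smul_eq_mul]
      linarith

/-- A finite `d`-degenerate symmetric irreflexive relation is properly colorable with `d + 1`
colors. -/
theorem exists_coloring_of_degenerate {ι : Type*} [Fintype ι] (r : ι → ι → Prop) (d : ℕ)
    (hsymm : ∀ i j, r i j → r j i) (hirr : ∀ i, ¬ r i i)
    (hd : ∀ S : Finset ι, S.Nonempty → ∃ i ∈ S, (S.filter (r i)).card ≤ d) :
    ∃ col : ι → Fin (d + 1), ∀ i j, r i j → col i ≠ col j := by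
  suffices h : ∀ S : Finset ι,
      ∃ col : ι → Fin (d + 1), ∀ i ∈ S, ∀ j ∈ S, r i j → col i ≠ col j by
    obtain ⟨col, hcol⟩ := h Finset.univ
    exact ⟨col, fun i j => hcol i (Finset.mem_univ i) j (Finset.mem_univ j)⟩
  intro S
  induction S using Finset.strongInduction with
  | H S ih =>
    rcases S.eq_empty_or_nonempty with rfl | hS
    · exact ⟨fun _ => 0, by simp⟩
    obtain ⟨v, hv, hdeg⟩ := hd S hS
    obtain ⟨col, hcol⟩ := ih _ (Finset.erase_ssubset hv)
    obtain ⟨c, hc⟩ : ∃ c, c ∉ (S.filter (r v)).image col := by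
      by_contra! hall
      have hcard := Finset.card_le_card fun c (_ : c ∈ Finset.univ) => hall c
      have himage := Finset.card_image_le (s := S.filter (r v)) (f := col)
      rw [Finset.card_univ, Fintype.card_fin] at hcard
      omega
    have hne : ∀ j ∈ S, r v j → c ≠ col j := fun j hj hvj hcj =>
      hc (Finset.mem_image.2 ⟨j, Finset.mem_filter.2 ⟨hj, hvj⟩, hcj.symm⟩)
    refine ⟨Function.update col v c, fun i hi j hj hij => ?_⟩
    by_cases hiv : i = v
    · subst hiv
      have hji : j ≠ i := fun h => hirr i (h ▸ hij)
      simpa [hji] using hne j hj hij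
    · by_cases hjv : j = v
      · subst hjv
        simpa [hiv] using (hne i hi (hsymm _ _ hij)).symm
      · simpa [hiv, hjv] using
          hcol i (Finset.mem_erase.2 ⟨hiv, hi⟩) j (Finset.mem_erase.2 ⟨hjv, hj⟩) hij

/-- If `P 1, …, P m` is a partition of `B` into nonempty parts with distinct
leaders `ℓ i ∈ A`, `P i ⊆ N(ℓ i)`, and every vertex of `A` has a neighbor in
at most `k` parts, then in the auxiliary graph `K` every induced subgraph
`K[S]` has at most `k·|S|` edges; hence `K` is `2k`-degenerate and properly
`(2k+1)`-colorable. -/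
theorem leader_graph_sparse
    (V : Type) [DecidableEq V] (G : BipGraph V) (m k : ℕ)
    (P : Fin m → Finset V) (hPne : ∀ i, (P i).Nonempty)
    (hPdisj : ∀ i j, i ≠ j → Disjoint (P i) (P j))
    (hPunion : Finset.univ.biUnion P = G.B)
    (ℓ : Fin m → V) (hinj : Function.Injective ℓ) (hA : ∀ i, ℓ i ∈ G.A)
    (hPN : ∀ i, P i ⊆ G.nbr (ℓ i))
    (hdeg : ∀ v ∈ G.A,
      (Finset.univ.filter (fun i : Fin m => (G.nbr v ∩ P i).Nonempty)).card ≤ k) :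
    (∀ S : Finset (Fin m),
      ((S ×ˢ S).filter (fun e => e.1 < e.2 ∧ leaderAdj G ℓ P e.1 e.2)).card ≤ k * S.card) ∧
    (∀ S : Finset (Fin m), S.Nonempty → ∃ i ∈ S,
      (S.filter (fun j => leaderAdj G ℓ P i j)).card ≤ 2 * k) ∧
    (∃ col : Fin m → Fin (2 * k + 1), ∀ i j, leaderAdj G ℓ P i j → col i ≠ col j) := by
  let R : Fin m → Fin m → Prop := fun i j => i ≠ j ∧ (G.nbr (ℓ i) ∩ P j).Nonempty
  have hadj : ∀ i j, leaderAdj G ℓ P i j ↔ R i j ∨ R j i := fun i j => by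
    simp only [leaderAdj, R, ne_comm (a := j), and_or_left]
  have hR : ∀ i, (Finset.univ.filter (R i)).card ≤ k := fun i =>
    (Finset.card_le_card (Finset.monotone_filter_right _ fun _ _ h => h.2)).trans
      (hdeg (ℓ i) (hA i))
  have hdegen : ∀ S : Finset (Fin m), S.Nonempty → ∃ i ∈ S,
      (S.filter (fun j => leaderAdj G ℓ P i j)).card ≤ 2 * k := fun S hS => by
    simp only [hadj]
    convert exists_card_symm_le R k hR S hS
  refine ⟨fun S => ?_, hdegen, exists_coloring_of_degenerate _ _ (fun i j h => ?_)
    (fun i h => h.1 rfl) hdegen⟩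
  · simp only [hadj]
    convert card_symm_edges_le R k hR S
  · exact ⟨h.1.symm, h.2.symm⟩
end

section
/- Let G = (A,B,E) be a bipartite graph, let c ≥ 1, and let G_1,…,G_m be a left branching of G with overlap at most k. Let M be the bipartite graph with sides A and [m] in which u ∈ A is adjacent to i ∈ [m] if and only if u is a vertex of G_i, and suppose that for every nonempty S ⊆ [m] we have |{N_M(u) ∩ S : u ∈ A}| ≤ c·|S|. Let K be the graph with vertex set [m] in which distinct i, j are adjacent if and only if V(G_i) ∩ V(G_j) ≠ ∅. Then K is (k(k−1)c)-degenerate. -/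
open scoped Classical

namespace BipGraph

variable {V : Type} [DecidableEq V]

/-- The vertex set of a bipartite graph. -/
def verts (G : BipGraph V) : Finset V := G.A ∪ G.B

end BipGraph

/-- A vertex shared by two distinct branches lies on the left side. -/
theorem IsLeftBranching.mem_left_of_mem_verts {V : Type} [DecidableEq V] {G : BipGraph V}
    {m : ℕ} {H : Fin m → BipGraph V} {ℓ : Fin m → V} (hbr : IsLeftBranching G H ℓ)
    {i j : Fin m} (hij : i ≠ j) {w : V} (hi : w ∈ (H i).verts) (hj : w ∈ (H j).verts) :
    w ∈ G.A := by
  rcases Finset.mem_union.mp hi with hi | hi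
  · exact (hbr.induced i).1 hi
  rcases Finset.mem_union.mp hj with hj | hj
  · exact (hbr.induced j).1 hj
  exact absurd hj (Finset.disjoint_left.mp (hbr.right_disj i j hij) hi)

/-- If `G 1, …, G m` is a left branching of overlap at most `k` of `G` and the
bipartite branch-membership graph `M` (with sides `A` and `[m]`, where `u` is
adjacent to `i` iff `u ∈ V(G i)`) has neighborhood complexity linear with
constant `c`, then the intersection graph `K` of the branches is
`(k·(k−1)·c)`-degenerate. -/
theorem branch_intersection_degenerate
    (V : Type) [DecidableEq V] (G : BipGraph V) (c k m : ℕ) (hc : 1 ≤ c)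
    (H : Fin m → BipGraph V) (ℓ : Fin m → V)
    (hbr : IsLeftBranching G H ℓ)
    (hoverlap : ∀ v : V,
      (Finset.univ.filter (fun i : Fin m => v ∈ (H i).verts)).card ≤ k)
    (hnc : ∀ S : Finset (Fin m), S.Nonempty →
      (G.A.image (fun u => S.filter (fun i => u ∈ (H i).verts))).card ≤ c * S.card) :
    ∀ S : Finset (Fin m), S.Nonempty → ∃ i ∈ S,
      (S.filter (fun j => j ≠ i ∧ ((H i).verts ∩ (H j).verts).Nonempty)).card
        ≤ k * (k - 1) * c := by
  intro S hS
  by_contra! hdeg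
  have hpairs : (S.sigma (fun i => S.filter
      (fun j => j ≠ i ∧ ((H i).verts ∩ (H j).verts).Nonempty))).card
      ≤ ((G.A.image (fun u => S.filter (fun i => u ∈ (H i).verts))).biUnion
        Finset.offDiag).card := by
    refine Finset.card_le_card_of_injOn (fun p => (p.1, p.2)) ?_ ?_
    · rintro ⟨i, j⟩ hp
      simp only [Finset.mem_coe, Finset.mem_sigma, Finset.mem_filter] at hp
      obtain ⟨hi, hj, hji, w, hw⟩ := hp
      obtain ⟨hwi, hwj⟩ := Finset.mem_inter.mp hw
      have hwA : w ∈ G.A := hbr.mem_left_of_mem_verts hji.symm hwi hwj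
      simp only [Finset.mem_coe, Finset.mem_biUnion]
      exact ⟨_, Finset.mem_image_of_mem _ hwA, Finset.mem_offDiag.mpr
        ⟨Finset.mem_filter.mpr ⟨hi, hwi⟩, Finset.mem_filter.mpr ⟨hj, hwj⟩, hji.symm⟩⟩
    · rintro ⟨i, j⟩ - ⟨i', j'⟩ - h
      simp only [Prod.mk.injEq] at h
      obtain ⟨rfl, rfl⟩ := h
      rfl
  have hupper : ((G.A.image (fun u => S.filter (fun i => u ∈ (H i).verts))).biUnion
      Finset.offDiag).card ≤ c * S.card * (k * (k - 1)) := by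
    refine (Finset.card_biUnion_le_card_mul _ _ (k * (k - 1)) ?_).trans
      (Nat.mul_le_mul_right _ (hnc S hS))
    intro T hT
    obtain ⟨u, -, rfl⟩ := Finset.mem_image.mp hT
    have hcard : (S.filter (fun i => u ∈ (H i).verts)).card ≤ k :=
      (Finset.card_le_card (Finset.filter_subset_filter _ (Finset.subset_univ S))).trans
        (hoverlap u)
    rw [Finset.offDiag_card, ← Nat.mul_sub_one]
    exact Nat.mul_le_mul hcard (Nat.sub_le_sub_right hcard 1)
  have hlower := Finset.sum_lt_sum_of_nonempty hS hdeg
  rw [Finset.card_sigma] at hpairs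
  rw [Finset.sum_const, smul_eq_mul] at hlower
  refine absurd (hlower.trans_le (hpairs.trans hupper)) (not_lt.mpr (le_of_eq ?_))
  ring
end

section
/- Let T be a finite rooted tree of height at most h, let U be a set, and let V : V(T) → 𝒫(U) assign a subset of U to every node so that V(q) ⊆ V(p) whenever p is the parent of q. Let s ≥ 1 and suppose that for every node p of T, the graph on the children of p in which two children q, q' are adjacent if and only if V(q) ∩ V(q') ≠ ∅ admits a proper coloring with at most s colors. Then there exists a coloring λ of the nodes of T using at most Σ_{i=0}^{h} s^i colors such that any two distinct nodes p ≠ q with λ(p) = λ(q) satisfy V(p) ∩ V(q) = ∅. -/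
/-- An injection of a disjoint union of the sets `Fin (s ^ i)`, `i ≤ h`, into the palette. -/
lemma exists_injective_sigma_pow (s h : ℕ) :
    ∃ f : (Σ i : Fin (h + 1), Fin (s ^ (i : ℕ))) → Fin (∑ i ∈ Finset.range (h + 1), s ^ i),
      Function.Injective f :=
  ⟨fun x => (finSigmaFinEquiv x).cast (Fin.sum_univ_eq_sum_range (fun i => s ^ i) (h + 1)),
    (Fin.cast_injective _).comp finSigmaFinEquiv.injective⟩

/-- The nodes at a fixed depth `d` can be colored with `s ^ d` colors so that
distinct nodes of equal color carry disjoint sets. -/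
lemma ParentTree.exists_level_coloring {ι U : Type} (T : ParentTree ι) (Vass : ι → Set U)
    (hmono : ∀ q, q ≠ T.root → Vass q ⊆ Vass (T.parent q)) (s : ℕ)
    (hchild : ∀ p : ι, ∃ col : ι → Fin s,
      ∀ q q' : ι, q ≠ T.root → T.parent q = p → q' ≠ T.root → T.parent q' = p →
        q ≠ q' → (Vass q ∩ Vass q').Nonempty → col q ≠ col q') (d : ℕ) :
    ∃ c : ι → Fin (s ^ d), ∀ p q : ι, T.depth p = d → T.depth q = d → p ≠ q →
      c p = c q → Vass p ∩ Vass q = ∅ := by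
  induction d with
  | zero =>
    have eq_root (p : ι) (hp : T.depth p = 0) : p = T.root := by
      by_contra hne
      have := T.parent_depth p hne
      omega
    exact ⟨fun _ => ⟨0, by simp⟩, fun p q hp hq hpq _ =>
      absurd ((eq_root p hp).trans (eq_root q hq).symm) hpq⟩
  | succ d ih =>
    obtain ⟨c, hc⟩ := ih
    choose col hcol using hchild
    have ne_root (p : ι) (hp : T.depth p = d + 1) : p ≠ T.root := by
      rintro rfl
      have := T.root_depth
      omega
    refine ⟨fun q => finProdFinEquiv (c (T.parent q), col (T.parent q) q), ?_⟩
    intro p q hp hq hpq heq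
    obtain ⟨hcpar, hcolpq⟩ := Prod.mk.inj (finProdFinEquiv.injective heq)
    have hp' := ne_root p hp
    have hq' := ne_root q hq
    have hpd := T.parent_depth p hp'
    have hqd := T.parent_depth q hq'
    by_cases hpar : T.parent p = T.parent q
    · by_contra hne
      rw [hpar] at hcolpq
      exact hcol _ p q hp' hpar hq' rfl hpq (Set.nonempty_iff_ne_empty.mpr hne) hcolpq
    · exact Set.subset_empty_iff.mp <|
        (Set.inter_subset_inter (hmono p hp') (hmono q hq')).trans
          (hc _ _ (by omega) (by omega) hpar hcpar).subset

/-- Tree-coloring lemma: given a rooted tree of height at most `h` with vertex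
sets `Vass p ⊆ U` that shrink along edges towards the leaves, if for every node
the intersection graph of the sets of its children is properly `s`-colorable,
then there is a coloring of all nodes with at most `∑ i ≤ h, s ^ i` colors so
that distinct nodes of equal color carry disjoint sets. -/
theorem tree_coloring
    (ι U : Type) [Fintype ι] [DecidableEq ι] (T : ParentTree ι)
    (h : ℕ) (hheight : ∀ p, T.depth p ≤ h)
    (Vass : ι → Set U)
    (hmono : ∀ q, q ≠ T.root → Vass q ⊆ Vass (T.parent q))
    (s : ℕ) (hs : 1 ≤ s)
    (hchild : ∀ p : ι, ∃ col : ι → Fin s,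
      ∀ q q' : ι, q ≠ T.root → T.parent q = p → q' ≠ T.root → T.parent q' = p →
        q ≠ q' → (Vass q ∩ Vass q').Nonempty → col q ≠ col q') :
    ∃ lam : ι → Fin (∑ i ∈ Finset.range (h + 1), s ^ i),
      ∀ p q : ι, p ≠ q → lam p = lam q → Vass p ∩ Vass q = ∅ := by
  choose c hc using T.exists_level_coloring Vass hmono s hchild
  obtain ⟨f, hf⟩ := exists_injective_sigma_pow s h
  refine ⟨fun p => f ⟨⟨T.depth p, Nat.lt_succ_of_le (hheight p)⟩, c (T.depth p) p⟩, ?_⟩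
  intro p q hpq heq
  obtain ⟨hdepth, hcolor⟩ := Sigma.mk.inj_iff.mp (hf heq)
  have hd : T.depth p = T.depth q := congrArg Fin.val hdepth
  have color_eq (d d' : ℕ) (hdd : d = d') (hh : c d p ≍ c d' q) : c d p = c d q := by
    subst hdd
    exact eq_of_heq hh
  exact hc _ p q rfl hd.symm hpq (color_eq _ _ hd hcolor)
end

section
/- Let τ, d, r ∈ ℕ, let H be a finite graph with more than d·|V(H)| edges, and let G be a τ-degenerate graph that contains as an induced subgraph a (≤r)-subdivision H' of H. Then more than (d − τ)·|V(H)| edges of H are subdivided at least once in H', i.e., are replaced in H' by a path with at least one internal vertex. -/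
open scoped Classical

/-- The full walk replacing the edge `uv`: the principal vertex `p u`, then
the internal path vertices, then `p v`. -/
def wlist {α β : Type} (p : α → β) (path : α → α → List β) (u v : α) : List β :=
  p u :: (path u v ++ [p v])

/-- `G` contains, as an induced subgraph, the `(≤ r)`-subdivision of `H` with
principal vertices `p` and with the edge `uv` replaced by the path through the
internal vertices `path u v` (at most `r` of them). -/
structure IsInducedLeSubdivision {α β : Type} (H : SimpleGraph α) (G : SimpleGraph β)
    (r : ℕ) (p : α → β) (path : α → α → List β) : Prop where
  p_inj : Function.Injective p
  symm : ∀ u v, path v u = (path u v).reverse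
  not_adj : ∀ u v, ¬ H.Adj u v → path u v = []
  len_le : ∀ u v, H.Adj u v → (path u v).length ≤ r
  nodup : ∀ u v, H.Adj u v → (path u v).Nodup
  not_principal : ∀ u v, H.Adj u v → ∀ x ∈ path u v, x ∉ Set.range p
  disjoint : ∀ u v u' v', H.Adj u v → H.Adj u' v' →
      ¬(u = u' ∧ v = v') → ¬(u = v' ∧ v = u') →
      ∀ x ∈ path u v, x ∉ path u' v'
  induced : ∀ x y : β,
      (x ∈ Set.range p ∨ ∃ u v, H.Adj u v ∧ x ∈ path u v) →
      (y ∈ Set.range p ∨ ∃ u v, H.Adj u v ∧ y ∈ path u v) →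
      (G.Adj x y ↔ ∃ u v, H.Adj u v ∧
        ((x, y) ∈ (wlist p path u v).zip (wlist p path u v).tail ∨
         (y, x) ∈ (wlist p path u v).zip (wlist p path u v).tail))

/-- `G` is `d`-degenerate: every nonempty (induced) subgraph has a vertex of
degree at most `d`. -/
def Degenerate {β : Type} [Fintype β] (G : SimpleGraph β) (d : ℕ) : Prop :=
  ∀ S : Finset β, S.Nonempty → ∃ v ∈ S, (S.filter (fun w => G.Adj v w)).card ≤ d

/-- In a `d`-degenerate graph, every vertex set `S` spans at most `d * |S|` edges. -/
theorem Degenerate.card_edges_inside_le {α : Type} [Fintype α] {G : SimpleGraph α} {d : ℕ}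
    (hG : Degenerate G d) (S : Finset α) :
    (G.edgeFinset.filter (fun e => ∀ x ∈ e, x ∈ S)).card ≤ d * S.card := by
  induction S using Finset.strongInduction with
  | H S ih =>
    rcases S.eq_empty_or_nonempty with rfl | hS
    · refine (Finset.card_eq_zero.2 (Finset.filter_eq_empty_iff.2 ?_)).le.trans (Nat.zero_le _)
      intro e _ h
      induction e with
      | h a b => exact absurd (h a (Sym2.mem_mk_left a b)) (Finset.notMem_empty a)
    · obtain ⟨v, hv, hdeg⟩ := hG S hS
      have hsub : G.edgeFinset.filter (fun e => ∀ x ∈ e, x ∈ S) ⊆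
          G.edgeFinset.filter (fun e => ∀ x ∈ e, x ∈ S.erase v) ∪
            (S.filter (fun w => G.Adj v w)).image (fun w => s(v, w)) := by
        intro e he
        induction e with
        | h a b =>
          simp only [Finset.mem_filter, SimpleGraph.mem_edgeFinset, SimpleGraph.mem_edgeSet,
            Sym2.mem_iff, forall_eq_or_imp, forall_eq] at he
          obtain ⟨hab, ha, hb⟩ := he
          simp only [Finset.mem_union, Finset.mem_filter, SimpleGraph.mem_edgeFinset,
            SimpleGraph.mem_edgeSet, Sym2.mem_iff, forall_eq_or_imp, forall_eq, Finset.mem_image,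
            Finset.mem_erase]
          by_cases hav : a = v
          · subst hav
            exact Or.inr ⟨b, ⟨hb, hab⟩, rfl⟩
          · by_cases hbv : b = v
            · subst hbv
              exact Or.inr ⟨a, ⟨ha, hab.symm⟩, Sym2.eq_swap⟩
            · exact Or.inl ⟨hab, ⟨hav, ha⟩, hbv, hb⟩
      calc _ ≤ _ := Finset.card_le_card hsub
        _ ≤ d * (S.erase v).card + d :=
          (Finset.card_union_le _ _).trans
            (Nat.add_le_add (ih _ (Finset.erase_ssubset hv)) (Finset.card_image_le.trans hdeg))
        _ = d * S.card := by rw [← Finset.card_erase_add_one hv, Nat.mul_succ]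

/-- A `d`-degenerate graph on `n` vertices has at most `d * n` edges. -/
theorem Degenerate.card_edgeFinset_le {α : Type} [Fintype α] {G : SimpleGraph α} {d : ℕ}
    [Fintype G.edgeSet] (hG : Degenerate G d) : G.edgeFinset.card ≤ d * Fintype.card α := by
  convert hG.card_edges_inside_le Finset.univ
  · simp
  · exact Finset.card_univ.symm

/-- A graph that maps injectively and homomorphically to a `d`-degenerate graph is
`d`-degenerate. -/
theorem Degenerate.of_injective {α β : Type} [Fintype α] [Fintype β] {H : SimpleGraph α}
    {G : SimpleGraph β} {d : ℕ} (hG : Degenerate G d) {f : α → β} (hf : Function.Injective f)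
    (hadj : ∀ a b, H.Adj a b → G.Adj (f a) (f b)) : Degenerate H d := by
  intro S hS
  obtain ⟨x, hx, hdeg⟩ := hG (S.image f) (hS.image f)
  obtain ⟨a, ha, rfl⟩ := Finset.mem_image.1 hx
  refine ⟨a, ha, le_trans ?_ hdeg⟩
  refine Finset.card_le_card_of_injOn f (fun b hb => ?_) hf.injOn
  have hb := Finset.mem_filter.1 hb
  exact Finset.mem_filter.2 ⟨Finset.mem_image_of_mem f hb.1, hadj a b hb.2⟩

/-- The ends of an edge that is not subdivided remain adjacent in the subdivision. -/
theorem IsInducedLeSubdivision.adj_of_path_eq_nil {α β : Type} {H : SimpleGraph α}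
    {G : SimpleGraph β} {r : ℕ} {p : α → β} {path : α → α → List β}
    (h : IsInducedLeSubdivision H G r p path) {u v : α} (huv : H.Adj u v)
    (hpath : path u v = []) : G.Adj (p u) (p v) :=
  (h.induced (p u) (p v) (Or.inl ⟨u, rfl⟩) (Or.inl ⟨v, rfl⟩)).2
    ⟨u, v, huv, Or.inl (by simp [wlist, hpath])⟩

/-- If `H` has more than `d·|V(H)|` edges and a `τ`-degenerate graph `G`
contains an induced `(≤ r)`-subdivision of `H`, then more than
`(d − τ)·|V(H)|` edges of `H` are subdivided at least once. -/
theorem many_subdivided_edges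
    (α β : Type) [Fintype α] [DecidableEq α] [Fintype β]
    (H : SimpleGraph α) [DecidableRel H.Adj] (G : SimpleGraph β)
    (τ d r : ℕ)
    (hdense : (d : ℤ) * (Fintype.card α : ℤ) < (H.edgeFinset.card : ℤ))
    (hdeg : Degenerate G τ)
    (p : α → β) (path : α → α → List β)
    (hsub : IsInducedLeSubdivision H G r p path) :
    ((d : ℤ) - (τ : ℤ)) * (Fintype.card α : ℤ) <
      ((H.edgeFinset.filter (fun e => ∃ u v, e = s(u, v) ∧ path u v ≠ [])).card : ℤ) := by
  let K : SimpleGraph α :=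
    { Adj := fun u v => H.Adj u v ∧ path u v = []
      symm := ⟨fun u v h => ⟨h.1.symm, by rw [hsub.symm u v, h.2, List.reverse_nil]⟩⟩
      loopless := ⟨fun u h => H.loopless.irrefl u h.1⟩ }
  have hK : K.edgeFinset.card ≤ τ * Fintype.card α :=
    (hdeg.of_injective hsub.p_inj
      fun a b (h : H.Adj a b ∧ path a b = []) => hsub.adj_of_path_eq_nil h.1 h.2).card_edgeFinset_le
  have hle : (H.edgeFinset.filter
      (fun e => ¬ ∃ u v, e = s(u, v) ∧ path u v ≠ [])).card ≤ K.edgeFinset.card := by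
    refine Finset.card_le_card fun e he => ?_
    obtain ⟨he, hnot⟩ := Finset.mem_filter.1 he
    induction e with
    | h a b =>
      rw [SimpleGraph.mem_edgeFinset, SimpleGraph.mem_edgeSet] at he ⊢
      exact ⟨he, by_contra fun h => hnot ⟨a, b, rfl, h⟩⟩
  have hsum := H.edgeFinset.card_filter_add_card_filter_not
    (fun e => ∃ u v, e = s(u, v) ∧ path u v ≠ [])
  zify at hK hle hsum
  linarith
end
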